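/- arXiv:math/0503745 — 4 statements merged into one kernel-verified Lean document; each statement's English description precedes it below -/
import Mathlib

section
/- Let G be a d-regular graph on n vertices and let d = λ₁ ≥ λ₂ ≥ … ≥ λₙ be the eigenvalues of its adjacency matrix. Set λ = max_{2 ≤ i ≤ n} |λᵢ|. Then for every two (not necessarily disjoint) subsets U, W of the vertex set, |e(U,W) − d·|U|·|W|/n| ≤ λ·√(|U|·|W|·(1 − |U|/n)·(1 − |W|/n)). -/
/-- `eCount G U W` is the number of edges of `G` with one endpoint in `U` and the other in `W`,
where edges contained in `U ∩ W` are counted twice (equivalently, the number of ordered pairs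
`(u, w) ∈ U × W` with `u` adjacent to `w`). -/
def eCount {V : Type*} [DecidableEq V] (G : SimpleGraph V) [DecidableRel G.Adj]
    (U W : Finset V) : ℕ :=
  ((U ×ˢ W).filter fun p => G.Adj p.1 p.2).card

open Matrix Finset in
/-- Parseval's identity for the eigenvector basis of a real symmetric matrix. -/
theorem Matrix.IsHermitian.sum_dotProduct_eigenvectorBasis_mul {V : Type*} [Fintype V]
    [DecidableEq V] {A : Matrix V V ℝ} (hA : A.IsHermitian) (x y : V → ℝ) :
    ∑ i, ((hA.eigenvectorBasis i).ofLp ⬝ᵥ x) * ((hA.eigenvectorBasis i).ofLp ⬝ᵥ y) = x ⬝ᵥ y := by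
  have h := hA.eigenvectorBasis.sum_inner_mul_inner (WithLp.toLp 2 x) (WithLp.toLp 2 y)
  simp only [EuclideanSpace.inner_eq_star_dotProduct, star_trivial] at h
  rw [dotProduct_comm x y, ← h]
  exact sum_congr rfl fun i _ => by rw [dotProduct_comm y]

open Matrix in
theorem Matrix.IsHermitian.eigenvectorBasis_dotProduct_mulVec {V : Type*} [Fintype V]
    [DecidableEq V] {A : Matrix V V ℝ} (hA : A.IsHermitian) (i : V) (y : V → ℝ) :
    (hA.eigenvectorBasis i).ofLp ⬝ᵥ A *ᵥ y =
      hA.eigenvalues i * ((hA.eigenvectorBasis i).ofLp ⬝ᵥ y) := by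
  have hT : Aᵀ = A := by simpa [IsHermitian, conjTranspose_eq_transpose_of_trivial] using hA
  rw [dotProduct_mulVec, ← mulVec_transpose, hT, hA.mulVec_eigenvectorBasis, smul_dotProduct,
    smul_eq_mul]

open Matrix Finset in
theorem Matrix.IsHermitian.abs_dotProduct_mulVec_le {V : Type*} [Fintype V]
    [DecidableEq V] {A : Matrix V V ℝ} (hA : A.IsHermitian) {c : ℝ} (hc : 0 ≤ c) (x y : V → ℝ)
    (hy : ∀ i, (hA.eigenvectorBasis i).ofLp ⬝ᵥ y ≠ 0 → |hA.eigenvalues i| ≤ c) :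
    |x ⬝ᵥ A *ᵥ y| ≤ c * √((x ⬝ᵥ x) * (y ⬝ᵥ y)) := by
  have hCS := Real.sum_mul_le_sqrt_mul_sqrt univ
    (fun i => |(hA.eigenvectorBasis i).ofLp ⬝ᵥ x|) (fun i => |(hA.eigenvectorBasis i).ofLp ⬝ᵥ y|)
  simp only [sq, abs_mul_abs_self, hA.sum_dotProduct_eigenvectorBasis_mul] at hCS
  have hx : 0 ≤ x ⬝ᵥ x := sum_nonneg fun i _ => mul_self_nonneg (x i)
  rw [Real.sqrt_mul hx]
  refine le_trans ?_ (mul_le_mul_of_nonneg_left hCS hc)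
  rw [← hA.sum_dotProduct_eigenvectorBasis_mul x (A *ᵥ y), mul_sum]
  refine (abs_sum_le_sum_abs _ _).trans (sum_le_sum fun i _ => ?_)
  rw [hA.eigenvectorBasis_dotProduct_mulVec, abs_mul, abs_mul]
  by_cases h : (hA.eigenvectorBasis i).ofLp ⬝ᵥ y = 0
  · simp [h]
  · calc _ = |hA.eigenvalues i| * (|(hA.eigenvectorBasis i).ofLp ⬝ᵥ x| *
          |(hA.eigenvectorBasis i).ofLp ⬝ᵥ y|) := by ring
      _ ≤ _ := by gcongr; exact hy i h

open Matrix Finset in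
/-- If `1` is an eigenvector for `d`, a vector orthogonal to `1` is orthogonal to the `k`-th
eigenvector as soon as `d` occurs in the spectrum at most at the index `k`. -/
theorem Matrix.IsHermitian.eigenvectorBasis_dotProduct_eq_zero {V : Type*} [Fintype V]
    [DecidableEq V] [Nonempty V] {A : Matrix V V ℝ} (hA : A.IsHermitian) {d : ℝ}
    (hd : A *ᵥ 1 = d • 1) {k : V} (hk : ∀ j, j ≠ k → hA.eigenvalues j ≠ d)
    {y : V → ℝ} (hy : 1 ⬝ᵥ y = 0) : (hA.eigenvectorBasis k).ofLp ⬝ᵥ y = 0 := by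
  have horth : ∀ j, j ≠ k → (hA.eigenvectorBasis j).ofLp ⬝ᵥ 1 = 0 := fun j hj => by
    have h := hA.eigenvectorBasis_dotProduct_mulVec j 1
    rw [hd, dotProduct_smul, smul_eq_mul] at h
    exact (mul_eq_mul_right_iff.mp h).resolve_left fun h' => hk j hj h'.symm
  have hsum : ∀ z : V → ℝ, ((hA.eigenvectorBasis k).ofLp ⬝ᵥ 1) *
      ((hA.eigenvectorBasis k).ofLp ⬝ᵥ z) = 1 ⬝ᵥ z := fun z => by
    rw [← hA.sum_dotProduct_eigenvectorBasis_mul 1 z]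
    symm
    exact Fintype.sum_eq_single k fun j hj => by rw [horth j hj, zero_mul]
  have hone : (hA.eigenvectorBasis k).ofLp ⬝ᵥ 1 ≠ 0 := fun h => by
    have := hsum 1
    simp [h, eq_comm (a := (0 : ℝ))] at this
  exact (mul_eq_zero.mp ((hsum y).trans hy)).resolve_left hone

/-- The indicator function of `U`, projected orthogonally to the constants. -/
noncomputable def centeredIndicator {V : Type*} [Fintype V] [DecidableEq V] (U : Finset V) :
    V → ℝ :=
  fun v => (if v ∈ U then 1 else 0) - (U.card : ℝ) / Fintype.card V

open Matrix in
theorem one_dotProduct_centeredIndicator {V : Type*} [Fintype V] [DecidableEq V] [Nonempty V]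
    (U : Finset V) : 1 ⬝ᵥ centeredIndicator U = 0 := by
  simp [dotProduct, centeredIndicator, Finset.sum_sub_distrib, mul_div_cancel₀]

open Matrix in
theorem centeredIndicator_dotProduct_self {V : Type*} [Fintype V] [DecidableEq V] [Nonempty V]
    (U : Finset V) : centeredIndicator U ⬝ᵥ centeredIndicator U =
      (U.card : ℝ) * (1 - (U.card : ℝ) / Fintype.card V) := by
  have h := one_dotProduct_centeredIndicator U
  simp only [dotProduct, Pi.one_apply, one_mul] at h
  calc _ = ∑ v, ((if v ∈ U then centeredIndicator U v else 0) -
        (U.card : ℝ) / Fintype.card V * centeredIndicator U v) :=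
      Finset.sum_congr rfl fun v _ => by
        nth_rewrite 1 [centeredIndicator]
        split_ifs <;> ring
    _ = _ := by
      rw [Finset.sum_sub_distrib, ← Finset.mul_sum, h, Finset.sum_ite_mem, Finset.univ_inter,
        Finset.sum_congr rfl fun v hv => by rw [centeredIndicator, if_pos hv]]
      simp only [Finset.sum_sub_distrib, Finset.sum_const, nsmul_eq_mul]
      ring

open Matrix in
theorem SimpleGraph.IsRegularOfDegree.adjMatrix_mulVec_one {V : Type*} [Fintype V]
    {G : SimpleGraph V} [DecidableRel G.Adj] {d : ℕ} (hreg : G.IsRegularOfDegree d) :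
    G.adjMatrix ℝ *ᵥ 1 = (d : ℝ) • 1 := by
  ext v
  have := SimpleGraph.adjMatrix_mulVec_const_apply_of_regular (α := ℝ) (a := 1) hreg (v := v)
  simpa using this

open Matrix in
theorem centeredIndicator_dotProduct_adjMatrix_mulVec {V : Type*} [Fintype V] [DecidableEq V]
    [Nonempty V] {G : SimpleGraph V} [DecidableRel G.Adj] {d : ℕ}
    (hreg : G.IsRegularOfDegree d) (U W : Finset V) :
    centeredIndicator U ⬝ᵥ G.adjMatrix ℝ *ᵥ centeredIndicator W =
      (eCount G U W : ℝ) - (d : ℝ) * U.card * W.card / Fintype.card V := by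
  have hone : (1 : V → ℝ) ⬝ᵥ G.adjMatrix ℝ *ᵥ centeredIndicator W = 0 := by
    rw [dotProduct_mulVec, ← mulVec_transpose, SimpleGraph.transpose_adjMatrix,
      hreg.adjMatrix_mulVec_one, smul_dotProduct, one_dotProduct_centeredIndicator, smul_zero]
  have hdecomp (S : Finset V) : centeredIndicator S =
      (fun v => if v ∈ S then (1 : ℝ) else 0) - ((S.card : ℝ) / Fintype.card V) • 1 := by
    ext v
    simp [centeredIndicator]
  have hcount : (fun v => if v ∈ U then (1 : ℝ) else 0) ⬝ᵥ
      G.adjMatrix ℝ *ᵥ (fun v => if v ∈ W then (1 : ℝ) else 0) = eCount G U W := by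
    simp only [eCount, Finset.card_filter, Finset.sum_product, dotProduct, mulVec,
      SimpleGraph.adjMatrix_apply, mul_ite, mul_one, mul_zero, ite_mul, one_mul, zero_mul,
      Finset.sum_ite_mem, Finset.univ_inter]
    push_cast
    rfl
  rw [hdecomp U, sub_dotProduct, smul_dotProduct, hone, smul_zero, sub_zero, hdecomp W,
    mulVec_sub, mulVec_smul, hreg.adjMatrix_mulVec_one, dotProduct_sub, hcount]
  congr 1
  simp [dotProduct]
  ring

/-- Let `G` be a `d`-regular graph on `n` vertices with eigenvalues
`d = μ 0 ≥ μ 1 ≥ … ≥ μ (n-1)` and let `lam = max_{i ≠ 0} |μ i|`. Then for every two (not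
necessarily disjoint) vertex subsets `U, W`,
`|e(U,W) − d|U||W|/n| ≤ lam·√(|U||W|(1 − |U|/n)(1 − |W|/n))`. -/
theorem stmt_0 {V : Type*} [Fintype V] [DecidableEq V] (G : SimpleGraph V)
    [DecidableRel G.Adj] (n d : ℕ) (hn : Fintype.card V = n) (hn2 : 2 ≤ n)
    (hreg : G.IsRegularOfDegree d)
    (hA : (G.adjMatrix ℝ).IsHermitian)
    (μ : Fin n → ℝ) (e : Fin n ≃ V) (hsorted : Antitone μ)
    (heig : ∀ i, μ i = hA.eigenvalues (e i))
    (hd : μ ⟨0, by omega⟩ = d)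
    (lam : ℝ)
    (hlam : IsGreatest {x : ℝ | ∃ i : Fin n, i ≠ ⟨0, by omega⟩ ∧ |μ i| = x} lam)
    (U W : Finset V) :
    |(eCount G U W : ℝ) - (d : ℝ) * U.card * W.card / n| ≤
      lam * Real.sqrt ((U.card : ℝ) * W.card * (1 - (U.card : ℝ) / n) *
        (1 - (W.card : ℝ) / n)) := by
  subst hn
  have : Nonempty V := Fintype.card_pos_iff.mp (by omega)
  obtain ⟨⟨i₁, -, hi₁⟩, hub⟩ := hlam
  have hlam0 : 0 ≤ lam := hi₁ ▸ abs_nonneg _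
  have hle : ∀ i, i ≠ ⟨0, by omega⟩ → |μ i| ≤ lam := fun i hi => hub ⟨i, hi, rfl⟩
  have key := hA.abs_dotProduct_mulVec_le hlam0 (centeredIndicator U) (centeredIndicator W) ?_
  · rw [centeredIndicator_dotProduct_adjMatrix_mulVec hreg, centeredIndicator_dotProduct_self,
      centeredIndicator_dotProduct_self] at key
    convert key using 3
    ring
  · intro v hv
    obtain ⟨i, rfl⟩ := e.surjective v
    rw [← heig]
    by_cases hi : i = ⟨0, by omega⟩
    · subst hi
      by_contra hlt
      refine hv (hA.eigenvectorBasis_dotProduct_eq_zero hreg.adjMatrix_mulVec_one ?_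
        (one_dotProduct_centeredIndicator W))
      intro w hw hwd
      obtain ⟨j, rfl⟩ := e.surjective w
      rw [← heig] at hwd
      exact hlt (by rw [hd, ← hwd]; exact hle j fun h => hw (by rw [h]))
    · exact hle i hi
end

section
/- Let G be an (n,d,λ)-graph with d − λ ≥ 2 and with n even. Then G has a perfect matching. -/
/-- An `(n,d,λ)`-graph: a `d`-regular graph on `n` vertices all of whose adjacency-matrix
eigenvalues, except the largest one `λ₁ = d`, are at most `lam` in absolute value. -/
def IsNDL {V : Type*} [Fintype V] [DecidableEq V] (G : SimpleGraph V) [DecidableRel G.Adj]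
    (n d : ℕ) (lam : ℝ) : Prop :=
  Fintype.card V = n ∧ G.IsRegularOfDegree d ∧
    ∃ (hA : (G.adjMatrix ℝ).IsHermitian) (i₀ : V),
      hA.eigenvalues i₀ = (d : ℝ) ∧ ∀ i : V, i ≠ i₀ → |hA.eigenvalues i| ≤ lam

open Finset Matrix in
/-- Spectral gap inequality: the quadratic form of `A` on `x` is controlled by the second
eigenvalue and the component of `x` along the eigenvector `y` of the isolated eigenvalue. -/
lemma Matrix.IsHermitian.dotProduct_mulVec_gap {V : Type*} [Fintype V] [DecidableEq V]
    {A : Matrix V V ℝ} (hA : A.IsHermitian) {μ lam : ℝ} {i₀ : V}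
    (h₀ : hA.eigenvalues i₀ = μ) (hi : ∀ i, i ≠ i₀ → hA.eigenvalues i ≤ lam) (hlt : lam < μ)
    {y : V → ℝ} (hy : A *ᵥ y = μ • y) (x : V → ℝ) :
    (μ - lam) * ((y ⬝ᵥ y) * (x ⬝ᵥ x) - (y ⬝ᵥ x) ^ 2) ≤
      (y ⬝ᵥ y) * (μ * (x ⬝ᵥ x) - x ⬝ᵥ A *ᵥ x) := by
  set c : V → (V → ℝ) → ℝ := fun i z => (hA.eigenvectorBasis i).ofLp ⬝ᵥ z with hc
  have hsum (z w : V → ℝ) : ∑ i, c i z * c i w = z ⬝ᵥ w := by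
    have := hA.eigenvectorBasis.sum_inner_mul_inner (WithLp.toLp 2 z) (WithLp.toLp 2 w)
    simpa [EuclideanSpace.inner_eq_star_dotProduct, hc, dotProduct_comm] using this
  have hcA (i : V) (z : V → ℝ) : c i (A *ᵥ z) = hA.eigenvalues i * c i z := by
    have hT : Aᵀ = A := by simpa [conjTranspose_eq_transpose_of_trivial] using hA.eq
    have hv := hA.mulVec_eigenvectorBasis i
    simp only [hc, dotProduct_mulVec]
    rw [← mulVec_transpose, hT, hv, smul_dotProduct, smul_eq_mul]
  have hcy (i : V) (hne : i ≠ i₀) : c i y = 0 := by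
    have h := hcA i y
    rw [hy] at h
    simp only [hc, dotProduct_smul, smul_eq_mul] at h
    have hlt' : hA.eigenvalues i < μ := (hi i hne).trans_lt hlt
    have : (μ - hA.eigenvalues i) * c i y = 0 := by simp only [hc]; linarith
    exact (mul_eq_zero.mp this).resolve_left (sub_pos.mpr hlt').ne'
  have hyz (z : V → ℝ) : y ⬝ᵥ z = c i₀ y * c i₀ z := by
    rw [← hsum, sum_eq_single i₀ (fun i _ hne => by rw [hcy i hne, zero_mul]) (by simp)]
  have hgap : (μ - lam) * (x ⬝ᵥ x - c i₀ x ^ 2) ≤ μ * (x ⬝ᵥ x) - x ⬝ᵥ A *ᵥ x := by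
    rw [← hsum x x, ← hsum x (A *ᵥ x), mul_sum, ← sum_sub_distrib,
      ← add_sum_erase _ _ (mem_univ i₀), ← add_sum_erase _ _ (mem_univ i₀), hcA, h₀]
    have : (μ - lam) * ∑ i ∈ univ.erase i₀, c i x * c i x ≤
        ∑ i ∈ univ.erase i₀, (μ * (c i x * c i x) - c i x * c i (A *ᵥ x)) := by
      rw [mul_sum]
      refine sum_le_sum fun i h => ?_
      rw [hcA]
      nlinarith [hi i (ne_of_mem_erase h), mul_self_nonneg (c i x)]
    nlinarith
  calc (μ - lam) * ((y ⬝ᵥ y) * (x ⬝ᵥ x) - (y ⬝ᵥ x) ^ 2)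
      = (c i₀ y * c i₀ y) * ((μ - lam) * (x ⬝ᵥ x - c i₀ x ^ 2)) := by
        rw [hyz x, hyz y]; ring
    _ ≤ (y ⬝ᵥ y) * (μ * (x ⬝ᵥ x) - x ⬝ᵥ A *ᵥ x) := by
        rw [hyz y]
        exact mul_le_mul_of_nonneg_left hgap (mul_self_nonneg _)

namespace SimpleGraph

variable {V : Type*} [Fintype V] [DecidableEq V] (G : SimpleGraph V) [DecidableRel G.Adj]

/-- The number of edges of `G` leaving the vertex set `U`. -/
def edgeBoundaryCard (U : Finset V) : ℕ := ∑ v ∈ U, (G.neighborFinset v \ U).card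

variable {G}

open Finset in
lemma sum_edgeBoundaryCard_le {ι : Type*} (T : Finset ι) (U : ι → Finset V) (S : Finset V)
    (hU : (T : Set ι).PairwiseDisjoint U)
    (hS : ∀ i ∈ T, ∀ v ∈ U i, G.neighborFinset v \ U i ⊆ S) :
    ∑ i ∈ T, G.edgeBoundaryCard (U i) ≤ ∑ w ∈ S, G.degree w := by
  have hle (i) (h : i ∈ T) :
      G.edgeBoundaryCard (U i) ≤ ∑ v ∈ U i, #(S.bipartiteAbove G.Adj v) :=
    sum_le_sum fun v hv => card_le_card fun w hw => by
      have := hS i h v hv hw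
      simp_all [bipartiteAbove]
  calc ∑ i ∈ T, G.edgeBoundaryCard (U i)
      ≤ ∑ i ∈ T, ∑ v ∈ U i, #(S.bipartiteAbove G.Adj v) := sum_le_sum hle
    _ = ∑ v ∈ T.biUnion U, #(S.bipartiteAbove G.Adj v) := (sum_biUnion hU).symm
    _ ≤ ∑ v, #(S.bipartiteAbove G.Adj v) := sum_le_sum_of_subset (subset_univ _)
    _ = ∑ w ∈ S, #(univ.bipartiteBelow G.Adj w) :=
        sum_card_bipartiteAbove_eq_sum_card_bipartiteBelow _
    _ = ∑ w ∈ S, G.degree w := by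
        refine sum_congr rfl fun w _ => ?_
        rw [← card_neighborFinset_eq_degree]
        congr 1
        ext v
        simp [bipartiteBelow, adj_comm]

end SimpleGraph

open Finset Matrix in
lemma IsNDL.mul_le_edgeBoundaryCard {V : Type*} [Fintype V] [DecidableEq V] {G : SimpleGraph V}
    [DecidableRel G.Adj] {n d : ℕ} {lam : ℝ} (h : IsNDL G n d lam) (hlt : lam < d)
    (U : Finset V) :
    ((d : ℝ) - lam) * (#U * (n - #U)) ≤ n * G.edgeBoundaryCard U := by
  obtain ⟨hn, hd, hA, i₀, h₀, hi⟩ := h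
  have hone : G.adjMatrix ℝ *ᵥ 1 = (d : ℝ) • (1 : V → ℝ) := by
    ext v
    simpa [Function.const_one] using
      G.adjMatrix_mulVec_const_apply_of_regular (a := (1 : ℝ)) hd (v := v)
  have key := hA.dotProduct_mulVec_gap h₀ (fun i hne => (le_abs_self _).trans (hi i hne)) hlt hone
    (fun v => if v ∈ U then 1 else 0)
  have h11 : (1 : V → ℝ) ⬝ᵥ 1 = n := by simp [hn]
  have hxx : (fun v => if v ∈ U then (1 : ℝ) else 0) ⬝ᵥ (fun v => if v ∈ U then 1 else 0) = #U := by
    simp [dotProduct]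
  have h1x : (1 : V → ℝ) ⬝ᵥ (fun v => if v ∈ U then 1 else 0) = #U := by
    simp [dotProduct]
  have hb : (d : ℝ) * #U - (fun v => if v ∈ U then (1 : ℝ) else 0) ⬝ᵥ
      (G.adjMatrix ℝ *ᵥ fun v => if v ∈ U then 1 else 0) = G.edgeBoundaryCard U := by
    have hcard (v : V) : (#(G.neighborFinset v \ U) : ℝ) = d - #(G.neighborFinset v ∩ U) := by
      rw [← hd v, ← G.card_neighborFinset_eq_degree, ← card_sdiff_add_card_inter (G.neighborFinset v) U]
      push_cast
      ring
    simp [dotProduct, SimpleGraph.edgeBoundaryCard, hcard, mul_comm]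
  rw [h11, hxx, h1x, hb] at key
  linarith

open Finset in
/-- Small vertex sets send out at least `d` edges. -/
lemma IsNDL.le_edgeBoundaryCard {V : Type*} [Fintype V] [DecidableEq V] {G : SimpleGraph V}
    [DecidableRel G.Adj] {n d : ℕ} {lam : ℝ} (h : IsNDL G n d lam) (hdl : 2 ≤ (d : ℝ) - lam)
    {U : Finset V} (hU : U.Nonempty) (hcard : 2 * #U ≤ n) : d ≤ G.edgeBoundaryCard U := by
  have hpos : 0 < #U := hU.card_pos
  rcases le_or_gt #U d with hle | hlt
  · have hv (v) (hv : v ∈ U) : d - (#U - 1) ≤ #(G.neighborFinset v \ U) := by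
      have hsub : G.neighborFinset v ∩ U ⊆ U.erase v := fun w hw => by
        simp only [mem_inter, SimpleGraph.mem_neighborFinset] at hw
        exact mem_erase.mpr ⟨hw.1.ne', hw.2⟩
      have h₁ := card_le_card hsub
      have h₂ := card_sdiff_add_card_inter (G.neighborFinset v) U
      rw [card_erase_of_mem hv] at h₁
      rw [G.card_neighborFinset_eq_degree, h.2.1 v] at h₂
      omega
    have hsum := card_nsmul_le_sum U _ _ hv
    refine le_trans ?_ hsum
    obtain ⟨k, hk⟩ := Nat.exists_eq_add_of_lt hpos
    obtain ⟨m, rfl⟩ := Nat.exists_eq_add_of_le hle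
    rw [hk, smul_eq_mul, show 0 + k + 1 + m - (0 + k + 1 - 1) = m + 1 by omega]
    nlinarith
  · have key := h.mul_le_edgeBoundaryCard (by linarith) U
    have hc : 2 * (#U : ℝ) ≤ n := by exact_mod_cast hcard
    have hu : (0 : ℝ) < #U := by exact_mod_cast hpos
    have h₁ : 2 * ((#U : ℝ) * (n - #U)) ≤ (d - lam) * (#U * (n - #U)) :=
      mul_le_mul_of_nonneg_right hdl (mul_nonneg hu.le (by linarith))
    have h₂ : (n : ℝ) * #U ≤ n * G.edgeBoundaryCard U := by nlinarith
    have h₃ : (#U : ℝ) ≤ G.edgeBoundaryCard U := le_of_mul_le_mul_left h₂ (by linarith)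
    exact hlt.le.trans (by exact_mod_cast h₃)

open Finset in
/-- Deleting a vertex set `S` from an `(n,d,λ)`-graph with `d - λ ≥ 2` leaves at most `#S + 1`
components. -/
lemma IsNDL.card_connectedComponent_deleteVerts_le {V : Type*} [Fintype V] [DecidableEq V]
    {G : SimpleGraph V} [DecidableRel G.Adj] {n d : ℕ} {lam : ℝ} (h : IsNDL G n d lam)
    (hdl : 2 ≤ (d : ℝ) - lam) (hd : 0 < d) (S : Set V) :
    Nat.card ((⊤ : G.Subgraph).deleteVerts S).coe.ConnectedComponent ≤ S.ncard + 1 := by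
  classical
  set H := ((⊤ : G.Subgraph).deleteVerts S).coe
  let U (c : H.ConnectedComponent) : Finset V :=
    univ.filter fun v => ∃ hv, H.connectedComponentMk ⟨v, hv⟩ = c
  have hne (c) : (U c).Nonempty := by
    induction c using SimpleGraph.ConnectedComponent.ind with
    | h v => exact ⟨v, mem_filter.mpr ⟨mem_univ _, v.2, rfl⟩⟩
  have hdisj {c c'} (hcc : c ≠ c') : Disjoint (U c) (U c') := by
    refine disjoint_left.mpr fun v hv hv' => hcc ?_
    simp only [U, mem_filter] at hv hv'
    obtain ⟨-, _, rfl⟩ := hv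
    exact hv'.2.choose_spec
  have hS (c) (v) (hv : v ∈ U c) : G.neighborFinset v \ U c ⊆ S.toFinset := by
    intro w hw
    simp only [mem_sdiff, SimpleGraph.mem_neighborFinset] at hw
    by_contra hwS
    rw [Set.mem_toFinset] at hwS
    simp only [U, mem_filter, mem_univ, true_and] at hv hw
    obtain ⟨hv', rfl⟩ := hv
    have hw' : w ∈ ((⊤ : G.Subgraph).deleteVerts S).verts := by simpa using hwS
    refine hw.2 ⟨hw', SimpleGraph.ConnectedComponent.connectedComponentMk_eq_of_adj ?_⟩
    simp only [H, SimpleGraph.Subgraph.coe_adj, SimpleGraph.Subgraph.deleteVerts_adj]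
    simp only [SimpleGraph.Subgraph.deleteVerts_verts, Set.mem_sdiff] at hv'
    exact ⟨hw'.1, hw'.2, hv'.1, hv'.2, hw.1.symm⟩
  have hle := SimpleGraph.sum_edgeBoundaryCard_le (univ.filter fun c => 2 * #(U c) ≤ n) U
    S.toFinset (fun c _ c' _ hcc => hdisj hcc) (fun c _ => hS c)
  have hge := card_nsmul_le_sum (univ.filter fun c => 2 * #(U c) ≤ n) _ d
    fun c hc => h.le_edgeBoundaryCard hdl (hne c) (mem_filter.mp hc).2
  have hsmall : #(univ.filter fun c => 2 * #(U c) ≤ n) ≤ #S.toFinset := by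
    refine Nat.le_of_mul_le_mul_right ?_ hd
    simpa [sum_congr rfl fun w _ => h.2.1 w] using hge.trans hle
  have hbig : #(univ.filter fun c => ¬ 2 * #(U c) ≤ n) ≤ 1 := by
    refine card_le_one.mpr fun c hc c' hc' => ?_
    by_contra hcc
    have h₁ := card_le_univ (U c ∪ U c')
    rw [card_union_of_disjoint (hdisj hcc), h.1] at h₁
    simp only [mem_filter] at hc hc'
    omega
  rw [Nat.card_eq_fintype_card, ← card_univ, Set.ncard_eq_toFinset_card',
    ← card_filter_add_card_filter_not (fun c => 2 * #(U c) ≤ n)]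
  exact add_le_add hsmall hbig

/-- Let `G` be an `(n,d,λ)`-graph with `d − λ ≥ 2` and `n` even. Then `G` has a perfect
matching. -/
theorem stmt_7 {V : Type*} [Fintype V] [DecidableEq V] (G : SimpleGraph V)
    [DecidableRel G.Adj] (n d : ℕ) (lam : ℝ)
    (h : IsNDL G n d lam) (hdl : 2 ≤ (d : ℝ) - lam) (hne : Even n) :
    ∃ M : G.Subgraph, M.IsPerfectMatching := by
  have hd : 0 < d := by
    obtain ⟨hn, -, hA, i₀, -, hi⟩ := h
    have hcard : 1 < Fintype.card V := by
      have := Fintype.card_pos_iff.mpr ⟨i₀⟩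
      obtain ⟨k, hk⟩ := hne
      omega
    have := Fintype.one_lt_card_iff_nontrivial.mp hcard
    obtain ⟨j, hj⟩ := exists_ne i₀
    have := (abs_nonneg _).trans (hi j hj)
    have : (0 : ℝ) < d := by linarith
    exact_mod_cast this
  refine SimpleGraph.tutte.mpr fun S hS => ?_
  have hle := h.card_connectedComponent_deleteVerts_le hdl hd S
  have hodd := SimpleGraph.odd_ncard_oddComponents ((⊤ : G.Subgraph).deleteVerts S).coe
  have hodd_le := Set.ncard_le_card ((⊤ : G.Subgraph).deleteVerts S).coe.oddComponents
  have hcompl := Set.ncard_add_ncard_compl S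
  have hcard : Nat.card ((⊤ : G.Subgraph).deleteVerts S).verts = Sᶜ.ncard := by
    rw [Nat.card_coe_set_eq, SimpleGraph.Subgraph.deleteVerts_verts,
      SimpleGraph.Subgraph.verts_top, Set.compl_eq_univ_sdiff]
  rw [hcard] at hodd
  rw [Nat.card_eq_fintype_card, h.1] at hcompl
  unfold SimpleGraph.IsTutteViolator at hS
  grind
end

section
/- There exists an absolute constant C > 0 such that the following holds. Let 0 < δ < 1 and let G be an (n,d,λ)-graph with d ≥ 2, d ≤ 0.9n and λ ≤ d^{1−δ}. Then the list-chromatic number of G satisfies χ_l(G) ≤ C·d/(δ·ln d). -/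
/-- `G` is `k`-choosable: for every assignment of a list (set) of `k` colors to each vertex,
there is a proper coloring of `G` choosing each vertex's color from its list. -/
def Choosable {V : Type*} (G : SimpleGraph V) (k : ℕ) : Prop :=
  ∀ L : V → Finset ℕ, (∀ v, (L v).card = k) →
    ∃ c : V → ℕ, (∀ v, c v ∈ L v) ∧ ∀ u v : V, G.Adj u v → c u ≠ c v

open Finset

theorem OrthonormalBasis.sum_dotProduct_mul_dotProduct {V : Type*} [Fintype V]
    (b : OrthonormalBasis V ℝ (EuclideanSpace ℝ V)) (x y : V → ℝ) :
    ∑ i, ((b i).ofLp ⬝ᵥ x) * ((b i).ofLp ⬝ᵥ y) = x ⬝ᵥ y := by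
  have h := b.sum_inner_mul_inner (WithLp.toLp 2 x) (WithLp.toLp 2 y)
  simp only [EuclideanSpace.inner_eq_star_dotProduct, star_trivial] at h
  rw [dotProduct_comm x y, ← h]
  exact sum_congr rfl fun i _ => by rw [dotProduct_comm y]

theorem IsNDL.sum_card_filter_adj_le {V : Type*} [Fintype V] [DecidableEq V]
    {G : SimpleGraph V} [DecidableRel G.Adj] {n d : ℕ} {lam : ℝ} (h : IsNDL G n d lam)
    (h0 : 0 ≤ lam) (hlt : lam < d) (U : Finset V) :
    ∑ u ∈ U, (#{w ∈ U | G.Adj u w} : ℝ) ≤ d * (#U : ℝ) ^ 2 / n + lam * #U := by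
  obtain ⟨hn, hreg, hA, i₀, hi₀, hi⟩ := h
  set b := hA.eigenvectorBasis with hb
  set x : V → ℝ := fun v => if v ∈ U then 1 else 0 with hx
  have hne : (n : ℝ) ≠ 0 := by
    rw [← hn]
    exact_mod_cast (Fintype.card_pos_iff.2 ⟨i₀⟩).ne'
  have heig (i : V) (y : V → ℝ) :
      (b i).ofLp ⬝ᵥ ((G.adjMatrix ℝ).mulVec y) = hA.eigenvalues i * ((b i).ofLp ⬝ᵥ y) := by
    rw [Matrix.dotProduct_mulVec, ← Matrix.mulVec_transpose, G.transpose_adjMatrix,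
      hb, hA.mulVec_eigenvectorBasis, smul_dotProduct, smul_eq_mul]
  have hone : (G.adjMatrix ℝ).mulVec 1 = (d : ℝ) • (1 : V → ℝ) := by
    ext v
    simp [SimpleGraph.adjMatrix_mulVec_apply, hreg v]
  have hzero (i : V) (hii : i ≠ i₀) : (b i).ofLp ⬝ᵥ (1 : V → ℝ) = 0 := by
    have h1 := heig i 1
    rw [hone, dotProduct_smul, smul_eq_mul] at h1
    have h2 := (abs_le.1 (hi i hii)).2
    have h3 : ((d : ℝ) - hA.eigenvalues i) * ((b i).ofLp ⬝ᵥ (1 : V → ℝ)) = 0 := by linarith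
    rcases mul_eq_zero.1 h3 with h4 | h4
    · linarith
    · exact h4
  have hp1 := b.sum_dotProduct_mul_dotProduct 1 1
  have hpx := b.sum_dotProduct_mul_dotProduct 1 x
  have hxx := b.sum_dotProduct_mul_dotProduct x x
  have hax := b.sum_dotProduct_mul_dotProduct x ((G.adjMatrix ℝ).mulVec x)
  rw [Fintype.sum_eq_single i₀ fun i hii => by rw [hzero i hii, zero_mul]] at hp1 hpx
  have e1 : (1 : V → ℝ) ⬝ᵥ 1 = n := by simp [dotProduct, ← hn]
  have e2 : (1 : V → ℝ) ⬝ᵥ x = #U := by simp [dotProduct, hx]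
  have e3 : x ⬝ᵥ x = #U := by simp [dotProduct, hx]
  have e4 : x ⬝ᵥ ((G.adjMatrix ℝ).mulVec x) = ∑ u ∈ U, (#{w ∈ U | G.Adj u w} : ℝ) := by
    have key (u : V) : (∑ w, if G.Adj u w then x u * x w else 0)
        = if u ∈ U then (#{w ∈ U | G.Adj u w} : ℝ) else 0 := by
      split_ifs with hu
      · simp only [hx, hu, if_true, one_mul, ← ite_and]
        rw [sum_boole]
        congr 2
        ext w
        simp [and_comm]
      · simp [hx, hu]
    rw [SimpleGraph.dotProduct_mulVec_adjMatrix, sum_congr rfl fun u _ => key u, sum_ite_mem,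
      univ_inter]
  rw [e1] at hp1
  rw [e2] at hpx
  rw [e3] at hxx
  rw [e4] at hax
  rw [← hax]
  set c : ℝ := (b i₀).ofLp ⬝ᵥ x with hc
  have hcc : c * c = (#U : ℝ) ^ 2 / n := by
    rw [eq_div_iff hne, ← hpx, ← hp1]
    ring
  calc ∑ i, ((b i).ofLp ⬝ᵥ x) * ((b i).ofLp ⬝ᵥ (G.adjMatrix ℝ).mulVec x)
      ≤ ∑ i, ((if i = i₀ then (d : ℝ) * (c * c) else 0)
          + lam * (((b i).ofLp ⬝ᵥ x) * ((b i).ofLp ⬝ᵥ x))) := by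
        refine sum_le_sum fun i _ => ?_
        rw [heig]
        split_ifs with hii
        · subst hii
          rw [hi₀, ← hc]
          nlinarith [mul_nonneg h0 (mul_self_nonneg c)]
        · nlinarith [mul_le_mul_of_nonneg_right (abs_le.1 (hi i hii)).2
            (mul_self_nonneg ((b i).ofLp ⬝ᵥ x))]
    _ = d * (#U : ℝ) ^ 2 / n + lam * #U := by
        rw [sum_add_distrib, sum_ite_eq' univ i₀, ← mul_sum, hxx, hcc, if_pos (mem_univ _),
          mul_div_assoc]

theorem choosable_of_degree_lt {V : Type*} [Fintype V] [DecidableEq V] {G : SimpleGraph V}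
    [DecidableRel G.Adj] {k : ℕ} (h : ∀ v, G.degree v < k) : Choosable G k := by
  intro L hL
  have key (S : Finset V) : ∃ c : V → ℕ, (∀ v ∈ S, c v ∈ L v) ∧
      ∀ u ∈ S, ∀ v ∈ S, G.Adj u v → c u ≠ c v := by
    induction S using Finset.induction_on with
    | empty => exact ⟨0, by simp, by simp⟩
    | insert v S hv ih =>
      obtain ⟨c, hc, hp⟩ := ih
      have hlt : #((G.neighborFinset v).image c) < #(L v) :=
        card_image_le.trans_lt (by rw [hL]; exact h v)
      obtain ⟨y, hy, hyn⟩ := exists_mem_notMem_of_card_lt_card hlt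
      have hne (u : V) (hu : G.Adj v u) : c u ≠ y := fun he =>
        hyn (mem_image.2 ⟨u, by simpa using hu, he⟩)
      have hS (u : V) (hu : u ∈ S) : u ≠ v := fun he => hv (he ▸ hu)
      refine ⟨Function.update c v y, fun u hu => ?_, fun u hu w hw huw => ?_⟩
      · rcases mem_insert.1 hu with rfl | hu
        · simpa using hy
        · simpa [hS u hu] using hc u hu
      · rcases mem_insert.1 hu with rfl | hu' <;> rcases mem_insert.1 hw with rfl | hw'
        · exact absurd huw (G.loopless.irrefl _)
        · simpa [hS w hw'] using (hne w huw).symm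
        · simpa [hS u hu'] using hne u huw.symm
        · simpa [hS u hu', hS w hw'] using hp u hu' w hw' huw
  obtain ⟨c, hc, hp⟩ := key univ
  exact ⟨c, fun v => hc v (mem_univ v), fun u v => hp u (mem_univ u) v (mem_univ v)⟩

theorem exists_isIndepSet_subset_of_sum_card_le {V : Type*} [DecidableEq V] {G : SimpleGraph V}
    [DecidableRel G.Adj] {q lam m₀ : ℝ} (hq : q ≤ 0.9) (hlam : 0 ≤ lam)
    (hm₀ : 0 < m₀) (hml : 20 * (lam + 1) ≤ q * m₀)
    (hG : ∀ U : Finset V, ∑ u ∈ U, (#{w ∈ U | G.Adj u w} : ℝ) ≤ q * (#U : ℝ) ^ 2 + lam * #U)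
    (j : ℕ) (U : Finset V) (hU : m₀ * Real.exp (4 * q * j) ≤ #U) :
    ∃ I ⊆ U, (∀ u ∈ I, ∀ w ∈ I, ¬ G.Adj u w) ∧ j + 1 ≤ #I := by
  have hq0 : 0 < q := by
    by_contra! hcon
    nlinarith
  induction j generalizing U with
  | zero =>
    have hpos : 0 < #U := by
      have : (0 : ℝ) < #U := hm₀.trans_le (by simpa using hU)
      exact_mod_cast this
    obtain ⟨u, hu⟩ := card_pos.1 hpos
    exact ⟨{u}, by simpa using hu, by simp, by simp⟩
  | succ j ih =>
    have hUm : m₀ ≤ #U := le_trans (le_mul_of_one_le_right hm₀.le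
      (Real.one_le_exp (by positivity))) hU
    have hUpos : (0 : ℝ) < #U := hm₀.trans_le hUm
    obtain ⟨u, hu, hdeg⟩ : ∃ u ∈ U, (#{w ∈ U | G.Adj u w} : ℝ) ≤ q * #U + lam := by
      refine exists_le_of_sum_le (card_pos.1 (by exact_mod_cast hUpos)) ?_
      rw [sum_const, nsmul_eq_mul]
      exact (hG U).trans (le_of_eq (by ring))
    set U' := {w ∈ U.erase u | ¬ G.Adj u w} with hU'
    have hcard : (#U : ℝ) = #U' + #{w ∈ U | G.Adj u w} + 1 := by
      have h1 := card_filter_add_card_filter_not (s := U.erase u) (fun w => G.Adj u w)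
      have h2 : {w ∈ U.erase u | G.Adj u w} = {w ∈ U | G.Adj u w} := by
        ext w
        simp only [mem_filter, mem_erase]
        exact ⟨fun h => ⟨h.1.2, h.2⟩, fun h => ⟨⟨h.2.ne', h.1⟩, h.2⟩⟩
      have h3 := card_erase_add_one hu
      rw [h2] at h1
      have : #U = #U' + #{w ∈ U | G.Adj u w} + 1 := by rw [hU']; omega
      exact_mod_cast this
    have hexp : Real.exp (-(4 * q)) ≤ 1 - 1.05 * q := by
      have hc := convexOn_exp.2 (Set.mem_univ (0 : ℝ)) (Set.mem_univ (-3.6 : ℝ))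
        (show 0 ≤ 1 - q / 0.9 by rw [sub_nonneg, div_le_one (by norm_num)]; exact hq)
        (show 0 ≤ q / 0.9 by positivity) (by ring)
      have he : Real.exp (-3.6) ≤ 0.055 := by
        have h1 : (2.7 : ℝ) ≤ Real.exp 1 := by linarith [Real.exp_one_gt_d9]
        have h2 : (2.7 : ℝ) ^ 3 ≤ Real.exp 3.6 := by
          calc (2.7 : ℝ) ^ 3 ≤ Real.exp 1 ^ 3 := by gcongr
            _ = Real.exp 3 := by rw [← Real.exp_nat_mul]; norm_num
            _ ≤ _ := Real.exp_le_exp.2 (by norm_num)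
        rw [Real.exp_neg]
        rw [inv_le_comm₀ (Real.exp_pos _) (by norm_num)]
        norm_num at h2 ⊢
        linarith
      simp only [smul_eq_mul, Real.exp_zero] at hc
      have h4 : (1 - q / 0.9) * 0 + q / 0.9 * (-3.6) = -(4 * q) := by ring
      rw [h4] at hc
      have h5 : q / 0.9 * Real.exp (-3.6) ≤ q / 0.9 * 0.055 :=
        mul_le_mul_of_nonneg_left he (by positivity)
      have h6 : q / 0.9 = q * (10 / 9) := by ring
      rw [h6] at hc h5
      linarith
    obtain ⟨I, hIU, hI, hjI⟩ := ih U' (by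
      have h1 : m₀ * Real.exp (4 * q * j)
          = m₀ * Real.exp (4 * q * (j + 1 : ℕ)) * Real.exp (-(4 * q)) := by
        rw [mul_assoc m₀, ← Real.exp_add]
        congr 2
        push_cast
        ring
      rw [h1]
      have h2 : m₀ * Real.exp (4 * q * (j + 1 : ℕ)) * Real.exp (-(4 * q))
          ≤ #U * (1 - 1.05 * q) :=
        mul_le_mul hU hexp (Real.exp_pos _).le hUpos.le
      nlinarith [mul_le_mul_of_nonneg_left hUm hq0.le])
    have huI : u ∉ I := fun h => by simpa [hU'] using hIU h
    refine ⟨insert u I, ?_, ?_, ?_⟩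
    · refine insert_subset hu fun w hw => ?_
      have := hIU hw
      simp only [hU', mem_filter, mem_erase] at this
      exact this.1.2
    · have hn (w : V) (hw : w ∈ I) : ¬ G.Adj u w := (mem_filter.1 (hIU hw)).2
      intro a ha b hb hab
      rcases mem_insert.1 ha with rfl | ha' <;> rcases mem_insert.1 hb with rfl | hb'
      · exact G.loopless.irrefl _ hab
      · exact hn b hb' hab
      · exact hn a ha' hab.symm
      · exact hI a ha' b hb' hab
    · rw [card_insert_of_notMem huI]
      omega

theorem exists_coloring_of_exists_isIndepSet {V : Type*} [DecidableEq V] {G : SimpleGraph V}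
    {s m : ℝ} (hs : 0 < s) (hm : 0 < m)
    (hI : ∀ U : Finset V, m ≤ #U → ∃ I ⊆ U, (∀ u ∈ I, ∀ w ∈ I, ¬ G.Adj u w) ∧ s ≤ #I)
    (U : Finset V) (L : V → Finset ℕ) (hL : ∀ v ∈ U, #U / s + m ≤ #(L v)) :
    ∃ c : V → ℕ, (∀ v ∈ U, c v ∈ L v) ∧ ∀ u ∈ U, ∀ v ∈ U, G.Adj u v → c u ≠ c v := by
  induction U using Finset.strongInduction generalizing L with
  | H U ih =>
  by_cases hpop : ∃ x, m ≤ #{u ∈ U | x ∈ L u}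
  · obtain ⟨x, hx⟩ := hpop
    obtain ⟨I, hIU, hInd, hIs⟩ := hI _ hx
    have hIU' : I ⊆ U := hIU.trans (filter_subset _ _)
    have hne : I.Nonempty := card_pos.1 (by exact_mod_cast hs.trans_le hIs)
    obtain ⟨c, hc, hp⟩ := ih (U \ I) (sdiff_ssubset hIU' hne) (fun v => (L v).erase x) (by
      intro v hv
      have h1 := hL v (sdiff_subset hv)
      have h2 : ((#(U \ I) : ℕ) : ℝ) = #U - #I := by
        rw [card_sdiff_of_subset hIU', Nat.cast_sub (card_le_card hIU')]
      have h3 : (#(L v) : ℝ) ≤ #((L v).erase x) + 1 := by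
        have := pred_card_le_card_erase (s := L v) (a := x)
        exact_mod_cast (by omega : #(L v) ≤ #((L v).erase x) + 1)
      have h4 : 1 ≤ (#I : ℝ) / s := (one_le_div hs).2 hIs
      rw [h2, sub_div]
      linarith)
    refine ⟨fun v => if v ∈ I then x else c v, fun v hv => ?_, fun u hu v hv huv => ?_⟩
    · dsimp only
      split_ifs with h
      · exact (mem_filter.1 (hIU h)).2
      · exact erase_subset _ _ (hc v (mem_sdiff.2 ⟨hv, h⟩))
    · have hcx (w : V) (hw : w ∈ U) (h : w ∉ I) : c w ≠ x :=
        ne_of_mem_erase (hc w (mem_sdiff.2 ⟨hw, h⟩))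
      dsimp only
      split_ifs with h1 h2 h2
      · exact absurd huv (hInd u h1 v h2)
      · exact (hcx v hv h2).symm
      · exact hcx u hu h1
      · exact hp u (mem_sdiff.2 ⟨hu, h1⟩) v (mem_sdiff.2 ⟨hv, h2⟩) huv
  · push Not at hpop
    obtain ⟨f, hf, hfL⟩ := (all_card_le_biUnion_card_iff_exists_injective
      (fun v : U => L v)).1 (by
        intro W
        have h1 : (#W : ℝ) * m ≤ ∑ v ∈ W, (#(L v) : ℝ) := by
          rw [← nsmul_eq_mul, ← sum_const]
          refine sum_le_sum fun v _ => le_trans ?_ (hL v v.2)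
          have : 0 ≤ (#U : ℝ) / s := by positivity
          linarith
        have h2 : ∑ v ∈ W, (#(L v) : ℝ) ≤ #(W.biUnion fun v => L v) * m := by
          have h3 : ∑ v ∈ W, #(L v)
              = ∑ x ∈ W.biUnion (fun v : U => L v), #(W.filter fun v : U => x ∈ L v) := by
            refine Eq.trans (sum_congr rfl fun v hv => ?_)
              (sum_card_bipartiteAbove_eq_sum_card_bipartiteBelow
                (fun (v : U) (x : ℕ) => x ∈ L v))
            congr 1
            ext x
            simp only [bipartiteAbove, mem_filter, mem_biUnion]
            exact ⟨fun h => ⟨⟨v, hv, h⟩, h⟩, fun h => h.2⟩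
          rw [← Nat.cast_sum, h3, Nat.cast_sum, ← nsmul_eq_mul, ← sum_const]
          refine sum_le_sum fun x _ => le_trans ?_ (hpop x).le
          rw [Nat.cast_le]
          refine card_le_card_of_injOn Subtype.val (fun v hv => ?_) Subtype.val_injective.injOn
          simpa using (mem_filter.1 hv).2
        exact_mod_cast le_of_mul_le_mul_right (h1.trans h2) hm)
    refine ⟨fun v => if h : v ∈ U then f ⟨v, h⟩ else 0, fun v hv => ?_, fun u hu v hv huv => ?_⟩
    · simpa [hv] using hfL ⟨v, hv⟩
    · simp only [hu, hv, dif_pos]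
      exact fun h => huv.ne (congrArg Subtype.val (hf h))

namespace SimpleGraph

variable {V : Type*} [Fintype V] [DecidableEq V] (G : SimpleGraph V) [DecidableRel G.Adj]
  (L : V → Finset ℕ)

/-- The proper colorings of `G.induce S` from the lists `L`, extended by `0` outside of `S`. -/
def listColorings (S : Finset V) : Finset (V → ℕ) :=
  {f ∈ Fintype.piFinset fun v => if v ∈ S then L v else {0} |
    ∀ u ∈ S, ∀ w ∈ S, G.Adj u w → f u ≠ f w}

/-- The colors in the list of `v` that `f` does not use on the neighbors of `v` in `S`. -/
def freeColors (S : Finset V) (f : V → ℕ) (v : V) : Finset ℕ :=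
  {x ∈ L v | ∀ w ∈ S, G.Adj v w → f w ≠ x}

variable {G L}

theorem mem_listColorings {S : Finset V} {f : V → ℕ} : f ∈ G.listColorings L S ↔
    (∀ v ∈ S, f v ∈ L v) ∧ (∀ v ∉ S, f v = 0) ∧
      ∀ u ∈ S, ∀ w ∈ S, G.Adj u w → f u ≠ f w := by
  rw [listColorings, mem_filter, Fintype.mem_piFinset, ← and_assoc]
  refine and_congr_left fun _ => ⟨fun h => ⟨fun v hv => ?_, fun v hv => ?_⟩, fun h v => ?_⟩
  · simpa [hv] using h v
  · simpa [hv] using h v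
  · by_cases hv : v ∈ S
    · simpa [hv] using h.1 v hv
    · simpa [hv] using h.2 v hv

theorem update_mem_listColorings {S : Finset V} {f : V → ℕ} {v : V} {x : ℕ}
    (hf : f ∈ G.listColorings L S) (hx : x ∈ G.freeColors L S f v) :
    Function.update f v x ∈ G.listColorings L (insert v S) := by
  rw [mem_listColorings] at hf ⊢
  obtain ⟨hxL, hxf⟩ := mem_filter.1 hx
  obtain ⟨h1, h2, h3⟩ := hf
  refine ⟨fun u hu => ?_, fun u hu => ?_, fun u hu w hw huw => ?_⟩
  · by_cases huv : u = v
    · subst huv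
      simpa using hxL
    · simpa [huv] using h1 u (mem_of_mem_insert_of_ne hu huv)
  · rw [mem_insert, not_or] at hu
    simpa [hu.1] using h2 u hu.2
  · by_cases huv : u = v <;> by_cases hwv : w = v
    · exact absurd (huv.trans hwv.symm) huw.ne
    · subst huv
      simpa [hwv] using (hxf w (mem_of_mem_insert_of_ne hw hwv) huw).symm
    · subst hwv
      simpa [huv] using hxf u (mem_of_mem_insert_of_ne hu huv) huw.symm
    · simpa [huv, hwv] using h3 u (mem_of_mem_insert_of_ne hu huv) w
        (mem_of_mem_insert_of_ne hw hwv) huw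

theorem sum_card_freeColors_le {S : Finset V} {v : V} (hv : v ∉ S) :
    ∑ f ∈ G.listColorings L S, #(G.freeColors L S f v) ≤ #(G.listColorings L (insert v S)) := by
  rw [← card_sigma]
  refine card_le_card_of_injOn (fun p => Function.update p.1 v p.2) (fun p hp => ?_) ?_
  · obtain ⟨h1, h2⟩ := mem_sigma.1 hp
    exact update_mem_listColorings h1 h2
  · rintro ⟨f, x⟩ hf ⟨g, y⟩ hg h
    have hfz := (mem_listColorings.1 (mem_sigma.1 hf).1).2.1 v hv
    have hgz := (mem_listColorings.1 (mem_sigma.1 hg).1).2.1 v hv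
    dsimp only at h hfz hgz
    have hxy : x = y := by simpa using congrFun h v
    have hfg : f = g := by
      have h' := congrArg (fun e => Function.update e v 0) h
      simp only [Function.update_idem] at h'
      rwa [← hfz, Function.update_eq_self, hfz, ← hgz, Function.update_eq_self] at h'
    subst hxy hfg
    rfl

theorem update_zero_mem_listColorings {S : Finset V} {f : V → ℕ} {u : V}
    (hf : f ∈ G.listColorings L S) :
    Function.update f u 0 ∈ G.listColorings L (S.erase u) := by
  rw [mem_listColorings] at hf ⊢
  obtain ⟨h1, h2, h3⟩ := hf
  refine ⟨fun w hw => ?_, fun w hw => ?_, fun w hw z hz hwz => ?_⟩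
  · rw [Function.update_of_ne (ne_of_mem_erase hw)]
    exact h1 w (mem_of_mem_erase hw)
  · by_cases hwu : w = u
    · simp [hwu]
    · rw [Function.update_of_ne hwu]
      exact h2 w fun h => hw (mem_erase.2 ⟨hwu, h⟩)
  · rw [Function.update_of_ne (ne_of_mem_erase hw), Function.update_of_ne (ne_of_mem_erase hz)]
    exact h3 w (mem_of_mem_erase hw) z (mem_of_mem_erase hz) hwz

theorem card_filter_card_freeColors_lt_le {S : Finset V} {u : V} (hu : u ∈ S) {T : ℝ}
    (hT : 0 ≤ T) :
    (#{f ∈ G.listColorings L S | (#(G.freeColors L S f u) : ℝ) < T} : ℝ)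
      ≤ T * #(G.listColorings L (S.erase u)) := by
  rw [card_eq_sum_card_fiberwise (f := fun f => Function.update f u 0)
    (t := G.listColorings L (S.erase u))
    (fun f hf => update_zero_mem_listColorings (mem_filter.1 hf).1), Nat.cast_sum, mul_comm,
    ← nsmul_eq_mul, ← sum_const]
  refine sum_le_sum fun g _ => ?_
  rcases eq_empty_or_nonempty {a ∈ {f ∈ G.listColorings L S |
    (#(G.freeColors L S f u) : ℝ) < T} | Function.update a u 0 = g} with h | ⟨f, hf⟩
  · rw [h]
    simpa using hT
  · simp only [mem_filter] at hf
    refine le_trans ?_ hf.1.2.le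
    rw [Nat.cast_le]
    refine card_le_card_of_injOn (fun a => a u) (fun a ha => ?_) (fun a ha b hb hab => ?_)
    · simp only [coe_filter, mem_filter, Set.mem_ofPred_eq] at ha
      obtain ⟨h1, -, h3⟩ := mem_listColorings.1 ha.1.1
      refine mem_filter.2 ⟨h1 u hu, fun w hw huw => ?_⟩
      have := congrFun (hf.2.trans ha.2.symm) w
      rw [Function.update_of_ne huw.ne', Function.update_of_ne huw.ne'] at this
      rw [this]
      exact (h3 u hu w hw huw).symm
    · simp only [coe_filter, mem_filter, Set.mem_ofPred_eq] at ha hb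
      dsimp only at hab
      have := congrArg (fun e => Function.update e u (b u)) (ha.2.trans hb.2.symm)
      simp only [Function.update_idem] at this
      rwa [Function.update_eq_self, ← hab, Function.update_eq_self] at this

end SimpleGraph

theorem mul_card_filter_le_of_forall_update_mem {V : Type*} [DecidableEq V]
    {F : Finset (V → ℕ)} {u : V} {x : ℕ} {a : ℝ} (Y : (V → ℕ) → Finset ℕ)
    (hY : ∀ f ∈ F, f u = x → a ≤ #(Y f) ∧ ∀ y ∈ Y f, Function.update f u y ∈ F) :
    a * #{f ∈ F | f u = x} ≤ #F := by
  calc a * #{f ∈ F | f u = x} = ∑ f ∈ F with f u = x, a := by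
        rw [sum_const, nsmul_eq_mul, mul_comm]
    _ ≤ ∑ f ∈ F with f u = x, (#(Y f) : ℝ) :=
        sum_le_sum fun f hf => (hY f (mem_filter.1 hf).1 (mem_filter.1 hf).2).1
    _ = #({f ∈ F | f u = x}.sigma Y) := by rw [card_sigma, Nat.cast_sum]
    _ ≤ #F := by
        rw [Nat.cast_le]
        refine card_le_card_of_injOn (fun p => Function.update p.1 u p.2) (fun p hp => ?_) ?_
        · obtain ⟨h1, h2⟩ := mem_sigma.1 hp
          exact (hY p.1 (mem_filter.1 h1).1 (mem_filter.1 h1).2).2 _ h2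
        · rintro ⟨f, y⟩ hf ⟨g, z⟩ hg h
          have hfx := (mem_filter.1 (mem_sigma.1 hf).1).2
          have hgx := (mem_filter.1 (mem_sigma.1 hg).1).2
          dsimp only at h hfx hgx
          have hyz : y = z := by simpa using congrFun h u
          have hfg : f = g := by
            have h' := congrArg (fun e => Function.update e u x) h
            simp only [Function.update_idem] at h'
            nth_rw 1 [← hfx] at h'
            rw [← hgx] at h'
            simpa using h'
          subst hyz hfg
          rfl

theorem mul_exp_le_sum_prod {V : Type*} {X : Finset ℕ} {W : Finset V} {k d : ℕ}
    (hX : #X = k) (hk : 0 < k) (hW : #W ≤ d) (Q : V → Finset ℕ) (hQ : ∀ u ∈ W, 4 ≤ #(Q u)) :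
    k * Real.exp (-(4 * d / k))
      ≤ ∑ x ∈ X, ∏ u ∈ W, if x ∈ Q u then 1 - 2 / (#(Q u) : ℝ) else 1 := by
  set a : ℝ := 4 * d / k with ha
  have hk' : (0 : ℝ) < k := by exact_mod_cast hk
  set z : ℕ → ℝ := fun x => ∑ u ∈ W, if x ∈ Q u then 4 / (#(Q u) : ℝ) else 0 with hz
  have hprod (x : ℕ) : Real.exp (-z x)
      ≤ ∏ u ∈ W, if x ∈ Q u then 1 - 2 / (#(Q u) : ℝ) else 1 := by
    rw [hz, ← sum_neg_distrib, Real.exp_sum]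
    refine prod_le_prod (fun _ _ => (Real.exp_pos _).le) fun u hu => ?_
    split_ifs
    · have h4 : (4 : ℝ) ≤ #(Q u) := by exact_mod_cast hQ u hu
      set y : ℝ := 2 / (#(Q u) : ℝ) with hy
      have hy0 : 0 ≤ y := by positivity
      have hy1 : y ≤ 1 / 2 := by
        rw [hy, div_le_iff₀ (by linarith)]
        linarith
      have h2 : (4 : ℝ) / #(Q u) = 2 * y := by rw [hy]; ring
      rw [h2, Real.exp_neg]
      have h3 : 1 + 2 * y ≤ Real.exp (2 * y) := by linarith [Real.add_one_le_exp (2 * y)]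
      rw [inv_le_comm₀ (Real.exp_pos _) (by linarith)]
      refine le_trans ?_ h3
      rw [inv_le_iff_one_le_mul₀ (by linarith)]
      nlinarith
    · simp
  have hsum : ∑ x ∈ X, z x ≤ a * k := by
    rw [hz, sum_comm, ha, div_mul_cancel₀ _ hk'.ne']
    calc ∑ u ∈ W, ∑ x ∈ X, (if x ∈ Q u then 4 / (#(Q u) : ℝ) else 0)
        ≤ ∑ u ∈ W, (4 : ℝ) := by
          refine sum_le_sum fun u hu => ?_
          have h4 : (0 : ℝ) < #(Q u) := by
            exact_mod_cast (lt_of_lt_of_le (by norm_num) (hQ u hu))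
          rw [← sum_filter, sum_const, nsmul_eq_mul, mul_div_assoc', div_le_iff₀ h4, mul_comm]
          have : #{x ∈ X | x ∈ Q u} ≤ #(Q u) := card_le_card fun x hx => (mem_filter.1 hx).2
          have : (#{x ∈ X | x ∈ Q u} : ℝ) ≤ #(Q u) := by exact_mod_cast this
          linarith
      _ ≤ 4 * d := by
          rw [sum_const, nsmul_eq_mul, mul_comm]
          have : (#W : ℝ) ≤ d := by exact_mod_cast hW
          linarith
  calc k * Real.exp (-a) ≤ ∑ x ∈ X, Real.exp (-a) * (1 + a - z x) := by
        rw [← mul_sum, mul_comm, sum_sub_distrib, sum_const, hX, nsmul_eq_mul]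
        refine mul_le_mul_of_nonneg_left ?_ (Real.exp_pos _).le
        linarith
    _ ≤ ∑ x ∈ X, Real.exp (-z x) := by
        refine sum_le_sum fun x _ => ?_
        have : Real.exp (-z x) = Real.exp (-a) * Real.exp (a - z x) := by
          rw [← Real.exp_add]
          ring_nf
        rw [this]
        refine mul_le_mul_of_nonneg_left ?_ (Real.exp_pos _).le
        linarith [Real.add_one_le_exp (a - z x)]
    _ ≤ _ := sum_le_sum fun x _ => hprod x

namespace SimpleGraph

variable {V : Type*} [Fintype V] [DecidableEq V] {G : SimpleGraph V} [DecidableRel G.Adj]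
  {L : V → Finset ℕ}

/-- If `N ⊆ S` and the vertices of `W ⊆ N` have many colors left by a fixed coloring `g` outside
of `N`, then a color `x` is avoided on `W` by a definite proportion of the extensions of `g`. -/
theorem card_mul_prod_le_card_filter {S N W : Finset V} {T : ℝ} (g : V → ℕ) (x : ℕ)
    (hNS : N ⊆ S) (hWN : W ⊆ N) (hT : 4 ≤ T)
    (hWT : ∀ u ∈ W, T ≤ #(G.freeColors L (S \ N) g u))
    (hWN' : ∀ u ∈ W, 2 * (#{w ∈ N | G.Adj u w} : ℝ) ≤ T) :
    (#{f ∈ G.listColorings L S | ∀ w ∉ N, f w = g w} : ℝ) *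
        ∏ u ∈ W, (if x ∈ G.freeColors L (S \ N) g u then
          1 - 2 / (#(G.freeColors L (S \ N) g u) : ℝ) else 1)
      ≤ #{f ∈ {f ∈ G.listColorings L S | ∀ w ∉ N, f w = g w} | ∀ u ∈ W, f u ≠ x} := by
  set F := {f ∈ G.listColorings L S | ∀ w ∉ N, f w = g w} with hF
  set Q := G.freeColors L (S \ N) g with hQ
  induction W using Finset.induction_on with
  | empty => simp
  | insert u W hu ih =>
    have ih' := ih ((subset_insert _ _).trans hWN) (fun w hw => hWN' w (mem_insert_of_mem hw))
      (fun w hw => hWT w (mem_insert_of_mem hw))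
    set A := {f ∈ F | ∀ u ∈ W, f u ≠ x} with hA
    have huN : u ∈ N := hWN (mem_insert_self _ _)
    have huT := hWT u (mem_insert_self _ _)
    have huN' := hWN' u (mem_insert_self _ _)
    have hfree (f : V → ℕ) (hf : f ∈ F) :
        G.freeColors L S f u ⊆ Q u ∧ Q u ⊆ G.freeColors L S f u ∪
          {w ∈ N | G.Adj u w}.image f := by
      have hfg := (mem_filter.1 hf).2
      refine ⟨fun y hy => ?_, fun y hy => ?_⟩
      · obtain ⟨h1, h2⟩ := mem_filter.1 hy
        refine mem_filter.2 ⟨h1, fun w hw huw => ?_⟩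
        rw [← hfg w (mem_sdiff.1 hw).2]
        exact h2 w (mem_sdiff.1 hw).1 huw
      · obtain ⟨h1, h2⟩ := mem_filter.1 hy
        by_cases hyN : y ∈ {w ∈ N | G.Adj u w}.image f
        · exact mem_union_right _ hyN
        · refine mem_union_left _ (mem_filter.2 ⟨h1, fun w hw huw he => ?_⟩)
          by_cases hwN : w ∈ N
          · exact hyN (mem_image.2 ⟨w, mem_filter.2 ⟨hwN, huw⟩, he⟩)
          · refine h2 w (mem_sdiff.2 ⟨hw, hwN⟩) huw ?_
            rw [← hfg w hwN, he]
    have hsplit : (#A : ℝ) = #{f ∈ A | f u = x} + #{f ∈ F | ∀ w ∈ insert u W, f w ≠ x} := by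
      rw [← card_filter_add_card_filter_not (s := A) (fun f => f u = x), Nat.cast_add]
      congr 3
      ext f
      simp only [hA, mem_filter, mem_insert, forall_eq_or_imp]
      tauto
    have hbound : (#{f ∈ A | f u = x} : ℝ) ≤ (if x ∈ Q u then 2 / (#(Q u) : ℝ) else 0) * #A := by
      split_ifs with hx
      · have hpos : (0 : ℝ) < #(Q u) := by linarith
        have := mul_card_filter_le_of_forall_update_mem (F := A) (u := u) (x := x)
          (a := #(Q u) / 2) (fun f => G.freeColors L S f u) (fun f hf _ => by
            have hfF := (mem_filter.1 hf).1
            refine ⟨?_, fun y hy => ?_⟩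
            · have h1 : #(Q u) ≤ #(G.freeColors L S f u) + #{w ∈ N | G.Adj u w} :=
                (card_le_card (hfree f hfF).2).trans
                  ((card_union_le _ _).trans (Nat.add_le_add_left card_image_le _))
              have h2 : (#(Q u) : ℝ) ≤ #(G.freeColors L S f u) + #{w ∈ N | G.Adj u w} := by
                exact_mod_cast h1
              linarith
            · have h1 := update_mem_listColorings (mem_filter.1 hfF).1 hy
              rw [insert_eq_of_mem (hNS huN)] at h1
              refine mem_filter.2 ⟨mem_filter.2 ⟨h1, fun w hw => ?_⟩, fun w hw => ?_⟩
              · rw [Function.update_of_ne (fun h : w = u => hw (h ▸ huN))]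
                exact (mem_filter.1 hfF).2 w hw
              · rw [Function.update_of_ne (fun h : w = u => hu (h ▸ hw))]
                exact (mem_filter.1 hf).2 w hw)
        rw [div_mul_eq_mul_div, le_div_iff₀ hpos]
        linarith
      · rw [zero_mul, Nat.cast_nonpos, card_eq_zero, filter_eq_empty_iff]
        rintro f hf rfl
        have hfF := (mem_filter.1 hf).1
        obtain ⟨h1, -, h3⟩ := mem_listColorings.1 (mem_filter.1 hfF).1
        exact hx ((hfree f hfF).1 (mem_filter.2 ⟨h1 u (hNS huN),
          fun w hw huw => (h3 u (hNS huN) w hw huw).symm⟩))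
    rw [prod_insert hu]
    set p : ℝ := if x ∈ Q u then 1 - 2 / (#(Q u) : ℝ) else 1 with hp
    have hp0 : 0 ≤ p := by
      rw [hp]
      split_ifs
      · rw [sub_nonneg, div_le_one (by linarith)]
        linarith
      · norm_num
    have hp1 : (if x ∈ Q u then 2 / (#(Q u) : ℝ) else 0) = 1 - p := by
      rw [hp]
      split_ifs <;> ring
    rw [hp1] at hbound
    calc (#F : ℝ) * (p * ∏ u ∈ W, if x ∈ Q u then 1 - 2 / (#(Q u) : ℝ) else 1)
        = p * ((#F : ℝ) * ∏ u ∈ W, if x ∈ Q u then 1 - 2 / (#(Q u) : ℝ) else 1) := by ring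
      _ ≤ p * #A := mul_le_mul_of_nonneg_left ih' hp0
      _ ≤ _ := by linarith

theorem mul_card_listColorings_le {k d : ℕ} {T ρ ℓ : ℝ} (hdeg : ∀ v, G.degree v ≤ d)
    (hE : ∀ N : Finset V, #N ≤ d → ∑ u ∈ N, (#{w ∈ N | G.Adj u w} : ℝ) ≤ ρ * d)
    (hL : ∀ v, #(L v) = k) (hk : 0 < k) (hℓ : 0 < ℓ)
    (hℓk : 2 * ℓ ≤ k * Real.exp (-(4 * d / k))) (hT : 4 ≤ T)
    (hTℓ : d * T / ℓ + 2 * ρ * d / T ≤ ℓ) (S : Finset V) (v : V) (hv : v ∉ S) :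
    ℓ * #(G.listColorings L S) ≤ #(G.listColorings L (insert v S)) := by
  induction S using Finset.strongInduction generalizing v with
  | H S ih =>
  set C := G.listColorings L S with hC
  set N := {u ∈ S | G.Adj v u} with hN
  have hNS : N ⊆ S := filter_subset _ _
  have hNd : #N ≤ d := by
    refine le_trans (card_le_card fun u hu => ?_) (hdeg v)
    simpa using (mem_filter.1 hu).2
  set heavy := {u ∈ N | T < 2 * (#{w ∈ N | G.Adj u w} : ℝ)} with hheavy
  let tight : (V → ℕ) → Finset V := fun f => {u ∈ N | (#(G.freeColors L (S \ N) f u) : ℝ) < T}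
  let r : (V → ℕ) → V → ℕ := fun f w => if w ∈ N then 0 else f w
  have hT0 : 0 < T := by linarith
  have hheavy_card : (#heavy : ℝ) ≤ 2 * ρ * d / T := by
    rw [le_div_iff₀ hT0, ← nsmul_eq_mul, ← sum_const]
    calc ∑ u ∈ heavy, T ≤ ∑ u ∈ heavy, 2 * (#{w ∈ N | G.Adj u w} : ℝ) :=
          sum_le_sum fun u hu => (mem_filter.1 hu).2.le
      _ ≤ ∑ u ∈ N, 2 * (#{w ∈ N | G.Adj u w} : ℝ) :=
          sum_le_sum_of_subset_of_nonneg (filter_subset _ _) fun _ _ _ => by positivity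
      _ ≤ 2 * ρ * d := by
          rw [← mul_sum]
          linarith [hE N hNd]
  have htight_card : ∑ f ∈ C, (#(tight f) : ℝ) ≤ d * T / ℓ * #C := by
    have h1 : ∑ f ∈ C, #(tight f)
        = ∑ u ∈ N, #{f ∈ C | (#(G.freeColors L (S \ N) f u) : ℝ) < T} :=
      sum_card_bipartiteAbove_eq_sum_card_bipartiteBelow _
    rw [← Nat.cast_sum, h1, Nat.cast_sum]
    calc ∑ u ∈ N, (#{f ∈ C | (#(G.freeColors L (S \ N) f u) : ℝ) < T} : ℝ)
        ≤ ∑ u ∈ N, T / ℓ * #C := by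
          refine sum_le_sum fun u hu => ?_
          have h2 : (#{f ∈ C | (#(G.freeColors L (S \ N) f u) : ℝ) < T} : ℝ)
              ≤ #{f ∈ C | (#(G.freeColors L S f u) : ℝ) < T} := by
            rw [Nat.cast_le]
            refine card_le_card (monotone_filter_right _ fun f _ hf => lt_of_le_of_lt ?_ hf)
            rw [Nat.cast_le]
            refine card_le_card (monotone_filter_right _ fun y _ hy w hw huw => ?_)
            exact hy w (mem_sdiff.1 hw).1 huw
          have h3 := card_filter_card_freeColors_lt_le (G := G) (L := L) (hNS hu) hT0.le
          have h4 := ih _ (erase_ssubset (hNS hu)) u (notMem_erase u S)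
          rw [insert_erase (hNS hu)] at h4
          refine h2.trans (h3.trans ?_)
          rw [div_mul_eq_mul_div, le_div_iff₀ hℓ, mul_assoc]
          refine mul_le_mul_of_nonneg_left ?_ hT0.le
          rw [mul_comm]
          exact h4
      _ ≤ d * T / ℓ * #C := by
          rw [sum_const, nsmul_eq_mul]
          have h5 : (#N : ℝ) ≤ d := by exact_mod_cast hNd
          have h6 : 0 ≤ T / ℓ * (#C : ℝ) := by positivity
          calc (#N : ℝ) * (T / ℓ * #C) ≤ d * (T / ℓ * #C) :=
                mul_le_mul_of_nonneg_right h5 h6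
            _ = _ := by ring
  have hfiber (g : V → ℕ) (hg : g ∈ C.image r) :
      ∑ f ∈ C with r f = g, (2 * ℓ - #heavy - #(tight f))
        ≤ ∑ f ∈ C with r f = g, (#(G.freeColors L S f v) : ℝ) := by
    set F := {f ∈ C | ∀ w ∉ N, f w = g w} with hF
    obtain ⟨g', -, hg'⟩ := mem_image.1 hg
    have hFr : {f ∈ C | r f = g} = F := by
      refine filter_congr fun f _ => ⟨fun h w hw => ?_, fun h => funext fun w => ?_⟩
      · simp [← h, r, hw]
      · by_cases hw : w ∈ N
        · simp [← hg', r, hw]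
        · simp [r, hw, h w hw]
    rw [hFr]
    have hfree (f : V → ℕ) (hf : f ∈ F) (u : V) :
        G.freeColors L (S \ N) f u = G.freeColors L (S \ N) g u := by
      refine filter_congr fun y _ => forall₂_congr fun w hw => ?_
      rw [(mem_filter.1 hf).2 w (mem_sdiff.1 hw).2]
    have htight (f : V → ℕ) (hf : f ∈ F) : tight f = tight g := by
      refine filter_congr fun u _ => ?_
      rw [hfree f hf]
    set B := heavy ∪ tight g with hB
    set W := N \ B with hW
    have hWmem (u : V) (hu : u ∈ W) : 2 * (#{w ∈ N | G.Adj u w} : ℝ) ≤ T ∧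
        T ≤ #(G.freeColors L (S \ N) g u) := by
      obtain ⟨h1, h2⟩ := mem_sdiff.1 hu
      rw [hB, mem_union, not_or] at h2
      constructor
      · by_contra! h
        exact h2.1 (mem_filter.2 ⟨h1, h⟩)
      · by_contra! h
        exact h2.2 (mem_filter.2 ⟨h1, h⟩)
    have hpt (f : V → ℕ) :
        (#{x ∈ L v | ∀ u ∈ W, f u ≠ x} : ℝ) ≤ #(G.freeColors L S f v) + #heavy + #(tight g) := by
      have h1 : {x ∈ L v | ∀ u ∈ W, f u ≠ x} ⊆ G.freeColors L S f v ∪ B.image f := by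
        intro x hx
        obtain ⟨hx1, hx2⟩ := mem_filter.1 hx
        by_cases hxB : x ∈ B.image f
        · exact mem_union_right _ hxB
        · refine mem_union_left _ (mem_filter.2 ⟨hx1, fun w hw hvw he => ?_⟩)
          have hwN : w ∈ N := mem_filter.2 ⟨hw, hvw⟩
          by_cases hwB : w ∈ B
          · exact hxB (mem_image.2 ⟨w, hwB, he⟩)
          · exact hx2 w (mem_sdiff.2 ⟨hwN, hwB⟩) he
      have h2 : #{x ∈ L v | ∀ u ∈ W, f u ≠ x}
          ≤ #(G.freeColors L S f v) + (#heavy + #(tight g)) :=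
        (card_le_card h1).trans ((card_union_le _ _).trans
          (Nat.add_le_add_left (card_image_le.trans (card_union_le _ _)) _))
      rw [add_assoc]
      exact_mod_cast h2
    have hsum : (#F : ℝ) * (2 * ℓ) ≤ ∑ f ∈ F, (#{x ∈ L v | ∀ u ∈ W, f u ≠ x} : ℝ) := by
      have hcomm : ∑ f ∈ F, #{x ∈ L v | ∀ u ∈ W, f u ≠ x}
          = ∑ x ∈ L v, #{f ∈ F | ∀ u ∈ W, f u ≠ x} :=
        sum_card_bipartiteAbove_eq_sum_card_bipartiteBelow _
      rw [← Nat.cast_sum, hcomm, Nat.cast_sum]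
      have hexp := mul_exp_le_sum_prod (hL v) hk ((card_le_card sdiff_subset).trans hNd)
        (W := W) (G.freeColors L (S \ N) g) (fun u hu => by
          exact_mod_cast hT.trans (hWmem u hu).2)
      refine (mul_le_mul_of_nonneg_left (hℓk.trans hexp) (Nat.cast_nonneg _)).trans ?_
      rw [mul_sum]
      exact sum_le_sum fun x _ => card_mul_prod_le_card_filter g x hNS sdiff_subset hT
        (fun u hu => (hWmem u hu).2) (fun u hu => (hWmem u hu).1)
    calc ∑ f ∈ F, (2 * ℓ - #heavy - #(tight f))
        = (#F : ℝ) * (2 * ℓ) - #F * (#heavy + #(tight g)) := by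
          rw [sum_congr rfl fun f hf => by rw [htight f hf], sum_const, nsmul_eq_mul]
          ring
      _ ≤ ∑ f ∈ F, (#{x ∈ L v | ∀ u ∈ W, f u ≠ x} : ℝ) - #F * (#heavy + #(tight g)) := by
          linarith
      _ = ∑ f ∈ F, ((#{x ∈ L v | ∀ u ∈ W, f u ≠ x} : ℝ) - (#heavy + #(tight g))) := by
          rw [sum_sub_distrib, sum_const, nsmul_eq_mul]
      _ ≤ ∑ f ∈ F, (#(G.freeColors L S f v) : ℝ) :=
          sum_le_sum fun f _ => by linarith [hpt f]
  have hmaps (f : V → ℕ) (hf : f ∈ C) : r f ∈ C.image r := mem_image_of_mem r hf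
  have htotal : ∑ f ∈ C, (2 * ℓ - #heavy - #(tight f))
      ≤ ∑ f ∈ C, (#(G.freeColors L S f v) : ℝ) := by
    rw [← sum_fiberwise_of_maps_to hmaps, ← sum_fiberwise_of_maps_to hmaps]
    exact sum_le_sum hfiber
  have hinsert : ∑ f ∈ C, (#(G.freeColors L S f v) : ℝ) ≤ #(G.listColorings L (insert v S)) := by
    exact_mod_cast sum_card_freeColors_le hv
  refine le_trans ?_ (htotal.trans hinsert)
  rw [sum_sub_distrib, sum_const, nsmul_eq_mul]
  have hfin : (#C : ℝ) * (#heavy + d * T / ℓ) ≤ #C * ℓ :=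
    mul_le_mul_of_nonneg_left (by linarith) (Nat.cast_nonneg _)
  nlinarith

theorem choosable_of_sparse_neighborhoods {k d : ℕ} {T ρ ℓ : ℝ}
    (hdeg : ∀ v, G.degree v ≤ d)
    (hE : ∀ N : Finset V, #N ≤ d → ∑ u ∈ N, (#{w ∈ N | G.Adj u w} : ℝ) ≤ ρ * d)
    (hk : 0 < k) (hℓ : 0 < ℓ)
    (hℓk : 2 * ℓ ≤ k * Real.exp (-(4 * d / k))) (hT : 4 ≤ T)
    (hTℓ : d * T / ℓ + 2 * ρ * d / T ≤ ℓ) : Choosable G k := by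
  intro L hL
  have hpos (S : Finset V) : 0 < #(G.listColorings L S) := by
    induction S using Finset.induction_on with
    | empty => exact card_pos.2 ⟨0, mem_listColorings.2 (by simp)⟩
    | insert v S hv ih =>
      have h1 := mul_card_listColorings_le hdeg hE hL hk hℓ hℓk hT hTℓ S v hv
      have h2 : (0 : ℝ) < #(G.listColorings L S) := by exact_mod_cast ih
      exact_mod_cast (mul_pos hℓ h2).trans_le h1
  obtain ⟨c, hc⟩ := card_pos.1 (hpos univ)
  obtain ⟨h1, -, h3⟩ := mem_listColorings.1 hc
  exact ⟨c, fun v => h1 v (mem_univ v), fun u v => h3 u (mem_univ u) v (mem_univ v)⟩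

end SimpleGraph

theorem IsNDL.mono {V : Type*} [Fintype V] [DecidableEq V] {G : SimpleGraph V}
    [DecidableRel G.Adj] {n d : ℕ} {lam lam' : ℝ} (h : IsNDL G n d lam) (hl : lam ≤ lam') :
    IsNDL G n d lam' := by
  obtain ⟨hn, hreg, hA, i₀, hi₀, hi⟩ := h
  exact ⟨hn, hreg, hA, i₀, hi₀, fun i hii => (hi i hii).trans hl⟩

theorem choosable_of_sum_card_le_of_dense {V : Type*} [Fintype V] [DecidableEq V]
    {G : SimpleGraph V} [DecidableRel G.Adj] {k : ℕ} {n D y : ℝ} (hn : Fintype.card V = n)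
    (hD : 0 < D) (hDn : D ≤ 0.9 * n) (hy : 96 ≤ y) (hlam : 1 ≤ D * Real.exp (-y))
    (hE : ∀ U : Finset V, ∑ u ∈ U, (#{w ∈ U | G.Adj u w} : ℝ)
      ≤ D * (#U : ℝ) ^ 2 / n + D * Real.exp (-y) * #U)
    (hnD : n ≤ D * Real.exp (y / 4)) (hk : 96 * D / y ≤ k) : Choosable G k := by
  intro L hL
  have hn0 : 0 < n := by linarith
  have hy0 : 0 < y := by linarith
  have hsq : 1 + y / 4 + (y / 4) ^ 2 / 2 ≤ Real.exp (y / 4) :=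
    Real.quadratic_le_exp_of_nonneg (by positivity)
  obtain ⟨c, hc, hp⟩ := exists_coloring_of_exists_isIndepSet (G := G)
    (s := y * n / (16 * D)) (m := n * Real.exp (-(y / 2))) (by positivity) (by positivity)
    (fun U hU => by
      obtain ⟨I, hIU, hI, hcard⟩ := exists_isIndepSet_subset_of_sum_card_le (G := G)
        (q := D / n) (lam := D * Real.exp (-y)) (m₀ := 40 * n * Real.exp (-y))
        ((div_le_iff₀ hn0).2 hDn) (by positivity) (by positivity)
        (by
          have : D / n * (40 * n * Real.exp (-y)) = 40 * (D * Real.exp (-y)) := by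
            field_simp
          rw [this]
          linarith)
        (fun U => (hE U).trans (le_of_eq (by ring)))
        ⌊y * n / (16 * D)⌋₊ U (by
          refine le_trans ?_ hU
          have h1 : 4 * (D / n) * (⌊y * n / (16 * D)⌋₊ : ℝ) ≤ y / 4 := by
            calc 4 * (D / n) * (⌊y * n / (16 * D)⌋₊ : ℝ) ≤ 4 * (D / n) * (y * n / (16 * D)) :=
                  mul_le_mul_of_nonneg_left (Nat.floor_le (by positivity)) (by positivity)
              _ = y / 4 := by
                  field_simp
                  norm_num
          have h2 : Real.exp (-(y / 2)) = Real.exp (-y) * Real.exp (y / 4) * Real.exp (y / 4) := by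
            rw [← Real.exp_add, ← Real.exp_add]
            ring_nf
          have h3 : 40 ≤ Real.exp (y / 4) := by nlinarith
          calc 40 * n * Real.exp (-y) * Real.exp (4 * (D / n) * (⌊y * n / (16 * D)⌋₊ : ℝ))
              ≤ 40 * n * Real.exp (-y) * Real.exp (y / 4) :=
                mul_le_mul_of_nonneg_left (Real.exp_le_exp.2 h1) (by positivity)
            _ = n * Real.exp (-y) * Real.exp (y / 4) * 40 := by ring
            _ ≤ n * Real.exp (-y) * Real.exp (y / 4) * Real.exp (y / 4) :=
                mul_le_mul_of_nonneg_left h3 (by positivity)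
            _ = n * Real.exp (-(y / 2)) := by
                rw [h2]
                ring)
      refine ⟨I, hIU, hI, (Nat.lt_floor_add_one _).le.trans ?_⟩
      exact_mod_cast hcard)
    univ L (fun v _ => by
      rw [hL v, card_univ, hn]
      refine le_trans ?_ hk
      have h1 : n / (y * n / (16 * D)) = 16 * D / y := by
        field_simp
      have h2 : n * Real.exp (-(y / 2)) ≤ 4 * D / y := by
        calc n * Real.exp (-(y / 2)) ≤ D * Real.exp (y / 4) * Real.exp (-(y / 2)) :=
              mul_le_mul_of_nonneg_right hnD (Real.exp_pos _).le
          _ = D * (Real.exp (y / 4))⁻¹ := by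
              rw [mul_assoc, ← Real.exp_add, ← Real.exp_neg]
              ring_nf
          _ ≤ D * (y / 4)⁻¹ := by
              refine mul_le_mul_of_nonneg_left ?_ hD.le
              refine inv_anti₀ (by positivity) ?_
              linarith [Real.add_one_le_exp (y / 4)]
          _ = 4 * D / y := by
              field_simp
      rw [h1]
      have h3 : 16 * D / y + 4 * D / y ≤ 96 * D / y := by
        rw [← add_div]
        gcongr
        linarith
      linarith)
  exact ⟨c, fun v => hc v (mem_univ v), fun u v => hp u (mem_univ u) v (mem_univ v)⟩

theorem choosable_of_sum_card_le_of_sparse {V : Type*} [Fintype V] [DecidableEq V]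
    {G : SimpleGraph V} [DecidableRel G.Adj] {k d : ℕ} {n y : ℝ}
    (hdeg : ∀ v, G.degree v ≤ d) (hy : 96 ≤ y) (hdy : Real.exp y ≤ d)
    (hE : ∀ U : Finset V, ∑ u ∈ U, (#{w ∈ U | G.Adj u w} : ℝ)
      ≤ d * (#U : ℝ) ^ 2 / n + d * Real.exp (-y) * #U)
    (hnD : d * Real.exp (y / 4) ≤ n) (hk : 96 * d / y ≤ k) : Choosable G k := by
  set D : ℝ := (d : ℝ) with hD
  have hD0 : 0 < D := (Real.exp_pos _).trans_le hdy
  have hy0 : 0 < y := by linarith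
  have hn0 : 0 < n := lt_of_lt_of_le (by positivity) hnD
  have hk0 : (0 : ℝ) < k := lt_of_lt_of_le (by positivity) hk
  set b : ℝ := Real.exp (-(y / 24)) with hb
  have hb0 : 0 < b := Real.exp_pos _
  have hpow (i : ℕ) : b ^ i = (Real.exp (i * (y / 24)))⁻¹ := by
    rw [hb, ← Real.exp_nat_mul, ← Real.exp_neg]
    ring_nf
  have hb4 : Real.exp (-(y / 4)) = b ^ 6 := by
    rw [hpow, ← Real.exp_neg]
    congr 1
    push_cast
    ring
  have hb3 : y ^ 3 * b ^ 3 ≤ 3072 := by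
    have h1 : (y / 8) ^ 3 / 6 ≤ Real.exp (y / 8) := by
      simpa [Nat.factorial] using Real.pow_div_factorial_le_exp (y / 8) (by positivity) 3
    rw [hpow, ← div_eq_mul_inv, div_le_iff₀ (Real.exp_pos _),
      show ((3 : ℕ) : ℝ) * (y / 24) = y / 8 by push_cast; ring]
    linarith [show (y / 8) ^ 3 / 6 = y ^ 3 / 3072 by ring]
  set ℓ : ℝ := k / 2 * Real.exp (-(4 * D / k)) with hℓ
  have hℓ0 : 0 < ℓ := by positivity
  have hℓb : 48 * D / y * b ≤ ℓ := by
    refine mul_le_mul ?_ ?_ hb0.le (by positivity)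
    · have : 48 * D / y = 96 * D / y / 2 := by ring
      linarith
    · refine Real.exp_le_exp.2 (neg_le_neg ?_)
      rw [div_le_iff₀ hk0]
      rw [div_le_iff₀ hy0] at hk
      linarith
  have hℓ3 : 8 * (2 * D * b ^ 6) * D ^ 2 ≤ ℓ ^ 3 := by
    refine le_trans ?_ (pow_le_pow_left₀ (by positivity) hℓb 3)
    have h1 : (48 * D / y * b) ^ 3 = 110592 * D ^ 3 * b ^ 3 / y ^ 3 := by
      field_simp
      norm_num
    rw [h1, le_div_iff₀ (by positivity)]
    calc 8 * (2 * D * b ^ 6) * D ^ 2 * y ^ 3 = 16 * D ^ 3 * b ^ 3 * (y ^ 3 * b ^ 3) := by ring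
      _ ≤ 16 * D ^ 3 * b ^ 3 * 3072 := mul_le_mul_of_nonneg_left hb3 (by positivity)
      _ ≤ 110592 * D ^ 3 * b ^ 3 := by
          have : 0 < D ^ 3 * b ^ 3 := by positivity
          linarith
  have hℓ2 : 8 * D ≤ ℓ ^ 2 := by
    refine le_trans ?_ (pow_le_pow_left₀ (by positivity) hℓb 2)
    have h1 : (48 * D / y * b) ^ 2 = 2304 * D ^ 2 * b ^ 2 / y ^ 2 := by
      field_simp
      norm_num
    rw [h1, le_div_iff₀ (by positivity)]
    have h2 : y ^ 2 ≤ 288 * (D * b ^ 2) := by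
      have h3 : Real.exp (y / 2) ≤ D * b ^ 2 := by
        calc Real.exp (y / 2) ≤ Real.exp y * b ^ 2 := by
              rw [hb, ← Real.exp_nat_mul, ← Real.exp_add]
              refine Real.exp_le_exp.2 ?_
              push_cast
              linarith
          _ ≤ D * b ^ 2 := mul_le_mul_of_nonneg_right hdy (by positivity)
      have h4 := Real.quadratic_le_exp_of_nonneg (show 0 ≤ y / 2 by positivity)
      nlinarith
    nlinarith [mul_le_mul_of_nonneg_left h2 (show 0 ≤ 8 * D by positivity)]
  refine SimpleGraph.choosable_of_sparse_neighborhoods (d := d) (T := ℓ ^ 2 / (2 * D))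
    (ρ := 2 * D * b ^ 6) (ℓ := ℓ) hdeg (fun N hN => ?_) (by exact_mod_cast hk0) hℓ0
    (by rw [hℓ]; exact le_of_eq (by ring)) ?_ ?_
  · refine (hE N).trans ?_
    have hN' : (#N : ℝ) ≤ D := by rw [hD]; exact_mod_cast hN
    have h1 : D * (#N : ℝ) ^ 2 / n ≤ D * D * b ^ 6 := by
      rw [div_le_iff₀ hn0]
      have h2 : D ≤ b ^ 6 * n := by
        rw [← hb4, Real.exp_neg, ← div_eq_inv_mul, le_div_iff₀ (Real.exp_pos _)]
        exact hnD
      calc D * (#N : ℝ) ^ 2 ≤ D * D ^ 2 := by gcongr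
        _ = D * D * D := by ring
        _ ≤ D * D * (b ^ 6 * n) := mul_le_mul_of_nonneg_left h2 (by positivity)
        _ = _ := by ring
    have h3 : D * Real.exp (-y) * #N ≤ D * b ^ 6 * D := by
      rw [← hb4]
      gcongr
      linarith
    linarith
  · rw [le_div_iff₀ (by positivity)]
    linarith
  · rw [← hD]
    have h1 : D * (ℓ ^ 2 / (2 * D)) / ℓ = ℓ / 2 := by
      field_simp
    have h2 : 2 * (2 * D * b ^ 6) * D / (ℓ ^ 2 / (2 * D)) ≤ ℓ / 2 := by
      rw [div_le_iff₀ (by positivity), mul_div_assoc', le_div_iff₀ (by positivity)]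
      linarith [show ℓ / 2 * ℓ ^ 2 = ℓ ^ 3 / 2 by ring,
        show 2 * (2 * D * b ^ 6) * D * (2 * D) = 8 * (2 * D * b ^ 6) * D ^ 2 / 2 by ring]
    linarith

/-- There exists an absolute constant `C > 0` such that: for every `0 < δ < 1` and every
`(n,d,λ)`-graph `G` with `d ≥ 2`, `d ≤ 0.9n` and `λ ≤ d^{1−δ}`, the list-chromatic number of
`G` satisfies `χ_l(G) ≤ C·d/(δ·ln d)`. -/
theorem stmt_14 :
    ∃ C : ℝ, 0 < C ∧
      ∀ (V : Type) (_ : Fintype V) (_ : DecidableEq V) (G : SimpleGraph V)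
        (_ : DecidableRel G.Adj) (n d : ℕ) (lam δ : ℝ),
        0 < δ → δ < 1 → IsNDL G n d lam → 2 ≤ d → (d : ℝ) ≤ 0.9 * n →
        lam ≤ (d : ℝ) ^ ((1 : ℝ) - δ) →
        ∃ k : ℕ, Choosable G k ∧ (k : ℝ) ≤ C * d / (δ * Real.log d) := by
  refine ⟨97, by norm_num, ?_⟩
  intro V _ _ G _ n d lam δ hδ0 hδ1 hG hd hdn hlam
  have hd' : (2 : ℝ) ≤ d := by exact_mod_cast hd
  have hd0 : (0 : ℝ) < d := by linarith
  have hlog : 0 < Real.log d := Real.log_pos (by linarith)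
  set y : ℝ := δ * Real.log d with hy
  have hy0 : 0 < y := mul_pos hδ0 hlog
  have hylog : y ≤ Real.log d := mul_le_of_le_one_left hlog.le hδ1.le
  have hyd : y ≤ d := hylog.trans (Real.log_le_self hd0.le)
  have hexpy : Real.exp y ≤ d := by
    rw [← Real.le_log_iff_exp_le hd0]
    exact hylog
  have hpow : (d : ℝ) ^ ((1 : ℝ) - δ) = d * Real.exp (-y) := by
    rw [Real.rpow_def_of_pos hd0]
    nth_rw 2 [← Real.exp_log hd0]
    rw [← Real.exp_add, hy]
    ring_nf
  have hlam1 : 1 ≤ d * Real.exp (-y) := by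
    rw [Real.exp_neg, ← div_eq_mul_inv, one_le_div (Real.exp_pos _)]
    exact hexpy
  rw [hpow] at hlam
  have hG' := hG.mono hlam
  have hlt : d * Real.exp (-y) < d :=
    mul_lt_of_lt_one_right hd0 (Real.exp_lt_one_iff.2 (neg_neg_of_pos hy0))
  have hE := hG'.sum_card_filter_adj_le (by positivity) hlt
  have hdeg (v : V) : G.degree v = d := hG.2.1 v
  have hk : 96 * (d : ℝ) / y ≤ ⌈96 * (d : ℝ) / y⌉₊ := Nat.le_ceil _
  refine ⟨⌈96 * (d : ℝ) / y⌉₊, ?_, ?_⟩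
  · by_cases hkd : d < ⌈96 * (d : ℝ) / y⌉₊
    · exact choosable_of_degree_lt fun v => (hdeg v).trans_lt hkd
    · have hy96 : 96 ≤ y := by
        have h1 : 96 * (d : ℝ) / y ≤ d := hk.trans (by exact_mod_cast not_lt.1 hkd)
        rw [div_le_iff₀ hy0, mul_comm] at h1
        exact le_of_mul_le_mul_left h1 hd0
      rcases le_total (n : ℝ) (d * Real.exp (y / 4)) with hn | hn
      · exact choosable_of_sum_card_le_of_dense (by exact_mod_cast hG.1) hd0 hdn hy96 hlam1 hE
          hn hk
      · exact choosable_of_sum_card_le_of_sparse (fun v => (hdeg v).le) hy96 hexpy hE hn hk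
  · have h1 := (Nat.ceil_lt_add_one (show 0 ≤ 96 * (d : ℝ) / y by positivity)).le
    have h2 : 1 ≤ (d : ℝ) / y := (one_le_div hy0).2 hyd
    have h3 : 97 * (d : ℝ) / y = 96 * d / y + d / y := by ring
    linarith
end

section
/- Let k ≥ 1 be a fixed integer. Let (G_i) be a sequence of graphs where G_i is an (n_i, d_i, λ_i)-graph with λ_i > 0, and suppose that d_i^{2k}/(n_i · λ_i^{2k−1}) → ∞ as i → ∞. Then for all sufficiently large i, the graph G_i contains a cycle of length 2k + 1. -/
open scoped RealInnerProductSpace in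
/-- If `u` is an eigenvector of a symmetric operator for a dominant simple eigenvalue `μ i₀`, then
the operator is close to the rank-one operator `μ i₀ • (projection on u)`. -/
theorem LinearMap.IsSymmetric.abs_inner_sub_le {ι E : Type*} [Fintype ι]
    [NormedAddCommGroup E] [InnerProductSpace ℝ E] (b : OrthonormalBasis ι ℝ E)
    {T : E →ₗ[ℝ] E} (hT : T.IsSymmetric) {μ : ι → ℝ} (hb : ∀ i, T (b i) = μ i • b i) {i₀ : ι}
    {lam : ℝ} (hlam0 : 0 ≤ lam) (hlam : ∀ i, i ≠ i₀ → |μ i| ≤ lam) (hlt : lam < μ i₀) {u : E}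
    (hu : T u = μ i₀ • u) (x y : E) :
    |‖u‖ ^ 2 * ⟪x, T y⟫ - μ i₀ * (⟪x, u⟫ * ⟪u, y⟫)| ≤ ‖u‖ ^ 2 * (lam * (‖x‖ * ‖y‖)) := by
  classical
  have hT' : ∀ i z, ⟪b i, T z⟫ = μ i * ⟪b i, z⟫ := fun i z => by
    rw [← hT, hb, real_inner_smul_left]
  have hortho : ∀ i, i ≠ i₀ → ⟪b i, u⟫ = 0 := fun i hi => by
    have h1 := hT' i u
    rw [hu, real_inner_smul_right] at h1
    have h2 : (μ i₀ - μ i) * ⟪b i, u⟫ = 0 := by linarith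
    rcases mul_eq_zero.1 h2 with h3 | h3
    · have := (le_abs_self _).trans (hlam i hi)
      linarith
    · exact h3
  have hu' : ⟪b i₀, u⟫ • b i₀ = u := by
    conv_rhs => rw [← b.sum_repr' u]
    rw [Finset.sum_eq_single i₀ (fun i _ hi => by rw [hortho i hi, zero_smul]) (by simp)]
  set c := ⟪b i₀, u⟫
  have hnorm : ‖u‖ ^ 2 = c ^ 2 := by
    rw [← hu', norm_smul, b.norm_eq_one, mul_one, Real.norm_eq_abs, sq_abs]
  have hxu : ⟪x, u⟫ = c * ⟪x, b i₀⟫ := by rw [← hu', real_inner_smul_right]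
  have huy : ⟪u, y⟫ = c * ⟪b i₀, y⟫ := by rw [← hu', real_inner_smul_left]
  have hexp : ⟪x, T y⟫ = ∑ i, μ i * (⟪x, b i⟫ * ⟪b i, y⟫) := by
    rw [← b.sum_inner_mul_inner x (T y)]
    refine Finset.sum_congr rfl fun i _ => ?_
    rw [hT']
    ring
  have hsplit : ‖u‖ ^ 2 * ⟪x, T y⟫ - μ i₀ * (⟪x, u⟫ * ⟪u, y⟫)
      = ‖u‖ ^ 2 * ∑ i ∈ Finset.univ.erase i₀, μ i * (⟪x, b i⟫ * ⟪b i, y⟫) := by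
    rw [hexp, ← Finset.add_sum_erase _ _ (Finset.mem_univ i₀), hxu, huy, hnorm]
    ring
  rw [hsplit, abs_mul, abs_of_nonneg (sq_nonneg ‖u‖)]
  refine mul_le_mul_of_nonneg_left ?_ (sq_nonneg _)
  calc |∑ i ∈ Finset.univ.erase i₀, μ i * (⟪x, b i⟫ * ⟪b i, y⟫)|
      ≤ ∑ i ∈ Finset.univ.erase i₀, lam * (|⟪x, b i⟫| * |⟪b i, y⟫|) := by
        refine (Finset.abs_sum_le_sum_abs _ _).trans (Finset.sum_le_sum fun i hi => ?_)
        rw [abs_mul, abs_mul]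
        exact mul_le_mul_of_nonneg_right (hlam i (Finset.ne_of_mem_erase hi)) (by positivity)
    _ ≤ lam * ∑ i, |⟪x, b i⟫| * |⟪b i, y⟫| := by
        rw [← Finset.mul_sum]
        refine mul_le_mul_of_nonneg_left ?_ hlam0
        exact Finset.sum_le_sum_of_subset_of_nonneg (Finset.erase_subset _ _)
          fun _ _ _ => by positivity
    _ ≤ lam * (‖x‖ * ‖y‖) := by
        refine mul_le_mul_of_nonneg_left ?_ hlam0
        have hcs := Real.sum_mul_le_sqrt_mul_sqrt Finset.univ
          (fun i => |⟪x, b i⟫|) (fun i => |⟪b i, y⟫|)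
        have h1 := b.sum_sq_norm_inner_left x
        have h2 := b.sum_sq_norm_inner_right y
        simp only [Real.norm_eq_abs] at h1 h2
        rwa [h1, h2, Real.sqrt_sq (norm_nonneg _), Real.sqrt_sq (norm_nonneg _)] at hcs

namespace SimpleGraph

open Finset

variable {V : Type*} {G : SimpleGraph V} [DecidableRel G.Adj]

/-- The number of pairs `(s, t) ∈ S × T` that are adjacent in `G`, as a real number. -/
def adjPairs (G : SimpleGraph V) [DecidableRel G.Adj] (S T : Finset V) : ℝ :=
  ∑ s ∈ S, ∑ t ∈ T, G.adjMatrix ℝ s t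

theorem adjPairs_univ [Fintype V] {d : ℕ} (hd : G.IsRegularOfDegree d) (S : Finset V) :
    G.adjPairs S univ = #S * d := by
  have h : ∀ s, ∑ t, G.adjMatrix ℝ s t = d := fun s => by
    simpa [Matrix.mulVec, dotProduct] using
      adjMatrix_mulVec_const_apply_of_regular (α := ℝ) (a := 1) (v := s) hd
  rw [adjPairs, sum_congr rfl fun s _ => h s, sum_const, nsmul_eq_mul]

theorem adjPairs_union_le [DecidableEq V] (S T₁ T₂ : Finset V) :
    G.adjPairs S (T₁ ∪ T₂) ≤ G.adjPairs S T₁ + G.adjPairs S T₂ := by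
  rw [adjPairs, adjPairs, adjPairs, ← sum_add_distrib]
  refine sum_le_sum fun s _ => ?_
  rw [← sum_union_inter]
  refine le_add_of_nonneg_right (sum_nonneg fun t _ => ?_)
  rw [adjMatrix_apply]
  split_ifs <;> norm_num

theorem adjPairs_eq_zero {S T : Finset V} (h : ∀ s ∈ S, ∀ t ∈ T, ¬ G.Adj s t) :
    G.adjPairs S T = 0 :=
  sum_eq_zero fun s hs => sum_eq_zero fun t ht => by simp [adjMatrix_apply, h s hs t ht]

variable [Fintype V] [DecidableEq V]

/-- The neighbours of a set `S` that lie outside `X`. -/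
def outerNeighbors (G : SimpleGraph V) [DecidableRel G.Adj] (S X : Finset V) : Finset V :=
  {t | t ∉ X ∧ ∃ s ∈ S, G.Adj s t}

theorem mem_outerNeighbors {S X : Finset V} {t : V} :
    t ∈ G.outerNeighbors S X ↔ t ∉ X ∧ ∃ s ∈ S, G.Adj s t := by
  simp [outerNeighbors]

theorem adjPairs_univ_le (S X : Finset V) :
    G.adjPairs S univ ≤ G.adjPairs S X + G.adjPairs S (G.outerNeighbors S X) := by
  have h0 : G.adjPairs S (univ \ (X ∪ G.outerNeighbors S X)) = 0 := by
    refine adjPairs_eq_zero fun s hs t ht hst => ?_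
    simp only [mem_sdiff, mem_univ, mem_union, mem_outerNeighbors, true_and, not_or] at ht
    exact ht.2 ⟨ht.1, s, hs, hst⟩
  calc G.adjPairs S univ
      = G.adjPairs S ((X ∪ G.outerNeighbors S X) ∪ (univ \ (X ∪ G.outerNeighbors S X))) := by
        rw [union_sdiff_of_subset (subset_univ _)]
    _ ≤ _ := adjPairs_union_le _ _ _
    _ ≤ _ := by
        rw [h0, add_zero]
        exact adjPairs_union_le _ _ _

end SimpleGraph

open Finset in
/-- The **expander mixing lemma**. -/
theorem IsNDL.mixing {V : Type*} [Fintype V] [DecidableEq V] {G : SimpleGraph V}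
    [DecidableRel G.Adj] {n d : ℕ} {lam : ℝ} (h : IsNDL G n d lam) (hlt : lam < d)
    (hn : 0 < n) (hlam : 0 < lam) (S T : Finset V) :
    |G.adjPairs S T - d * #S * #T / n| ≤ lam * √(#S * #T) := by
  obtain ⟨hcard, hreg, hA, i₀, hi₀, hev⟩ := h
  let ind : Finset V → EuclideanSpace ℝ V := fun S => WithLp.toLp 2 fun v => if v ∈ S then 1 else 0
  have hinner : ∀ S T : Finset V, inner ℝ (ind S) (ind T) = (#(S ∩ T) : ℝ) := fun S T => by
    simp [ind, PiLp.inner_apply, Finset.inter_comm]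
  have hnorm : ∀ S, ‖ind S‖ = √(#S) := fun S => by
    rw [norm_eq_sqrt_real_inner, hinner, inter_self]
  have hadj : inner ℝ (ind S) (Matrix.toEuclideanLin (G.adjMatrix ℝ) (ind T))
      = G.adjPairs S T := by
    simp [ind, PiLp.inner_apply, Matrix.mulVec, dotProduct, SimpleGraph.adjPairs,
      Finset.sum_ite_mem]
  have hu : Matrix.toEuclideanLin (G.adjMatrix ℝ) (ind univ)
      = hA.eigenvalues i₀ • ind univ := by
    rw [hi₀]
    ext v
    have := SimpleGraph.adjMatrix_mulVec_const_apply_of_regular (α := ℝ) (a := 1) (v := v) hreg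
    have h1 : (ind univ).ofLp = Function.const V 1 := by
      ext
      simp [ind]
    rw [Matrix.toLpLin_apply, h1]
    simpa [h1] using! this
  have key := (Matrix.isSymmetric_toEuclideanLin_iff.mpr hA).abs_inner_sub_le hA.eigenvectorBasis
    (μ := hA.eigenvalues) (i₀ := i₀) (fun i => by
      ext v
      have := congrFun (hA.mulVec_eigenvectorBasis i) v
      simpa [Matrix.toLpLin_apply] using! this) hlam.le hev (by rwa [hi₀]) hu (ind S) (ind T)
  have hn' : (0 : ℝ) < n := by exact_mod_cast hn
  rw [hadj, hinner, hinner, hnorm, hnorm, hnorm, hi₀, card_univ, hcard, Real.sq_sqrt hn'.le,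
    inter_univ, univ_inter, ← Real.sqrt_mul (Nat.cast_nonneg _)] at key
  have heq : (n : ℝ) * G.adjPairs S T - d * (#S * #T)
      = n * (G.adjPairs S T - d * #S * #T / n) := by
    field_simp
  rw [heq, abs_mul, abs_of_pos hn'] at key
  exact le_of_mul_le_mul_left key hn'

/-- Vertex expansion outside a forbidden set `X` that is not much larger than `S`. -/
theorem IsNDL.le_card_outerNeighbors {V : Type*} [Fintype V] [DecidableEq V] {G : SimpleGraph V}
    [DecidableRel G.Adj] {n d : ℕ} {lam : ℝ} (h : IsNDL G n d lam) (hlt : lam < d)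
    (hn : 0 < n) (hlam : 0 < lam) {S X : Finset V} {C : ℝ} (hXn : 4 * (X.card : ℝ) ≤ n)
    (hXS : (X.card : ℝ) ≤ C * S.card) (hC : 16 * C * lam ^ 2 ≤ (d : ℝ) ^ 2) :
    (n : ℝ) ≤ 4 * (G.outerNeighbors S X).card ∨
      (d : ℝ) ^ 2 * S.card ≤ 16 * lam ^ 2 * (G.outerNeighbors S X).card := by
  have h1 := (abs_le.1 (h.mixing hlt hn hlam S X)).2
  have h2 := (abs_le.1 (h.mixing hlt hn hlam S (G.outerNeighbors S X))).2
  have h3 := SimpleGraph.adjPairs_univ_le (G := G) S X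
  rw [SimpleGraph.adjPairs_univ h.2.1] at h3
  have hn' : (0 : ℝ) < n := by exact_mod_cast hn
  have hs : (0 : ℝ) ≤ S.card := Nat.cast_nonneg _
  have hx : (0 : ℝ) ≤ X.card := Nat.cast_nonneg _
  have ht : (0 : ℝ) ≤ (G.outerNeighbors S X).card := Nat.cast_nonneg _
  generalize ((G.outerNeighbors S X).card : ℝ) = t at *
  generalize (S.card : ℝ) = s at *
  generalize (X.card : ℝ) = x at *
  have hd : (0 : ℝ) < d := hlam.trans hlt
  generalize (d : ℝ) = d at *
  rcases hs.eq_or_lt with rfl | hs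
  · right
    rw [mul_zero]
    positivity
  refine or_iff_not_imp_left.2 fun hnt => ?_
  have hquarter : ∀ y : ℝ, 4 * y ≤ n → d * s * y / n ≤ d * s / 4 := fun y hy => by
    rw [div_le_div_iff₀ hn' (by norm_num)]
    nlinarith [mul_pos hd hs]
  have h4 := hquarter x hXn
  have h5 := hquarter t (not_le.1 hnt).le
  have h6 : lam * √(s * x) ≤ d * s / 4 := by
    refine abs_le_of_sq_le_sq' ?_ (by positivity) |>.2
    rw [mul_pow, Real.sq_sqrt (by positivity)]
    have e1 : lam ^ 2 * (s * x) ≤ lam ^ 2 * (s * (C * s)) := by gcongr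
    nlinarith [mul_le_mul_of_nonneg_right hC (sq_nonneg s)]
  have h7 : d * s / 4 ≤ lam * √(s * t) := by linarith
  have h8 : (d * s / 4) ^ 2 ≤ (lam * √(s * t)) ^ 2 := by gcongr
  rw [mul_pow, Real.sq_sqrt (by positivity)] at h8
  refine le_of_mul_le_mul_left ?_ hs
  linarith

namespace SimpleGraph

/-- Two families of `m` paths of length `i` starting at `v`, with `m` distinct endpoints each,
such that paths from different families meet only in `v`, and all of the paths together cover at
most `(2 * i + 1) * m` vertices. -/
def HasTwinArms {V : Type*} [DecidableEq V] (G : SimpleGraph V) (v : V) (i m : ℕ)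
    (X Y A B : Finset V) : Prop :=
  (∀ x ∈ X, x ∈ Y → x = v) ∧ (X ∪ Y).card ≤ (2 * i + 1) * m ∧ A.card = m ∧ B.card = m ∧
    (∀ a ∈ A, ∃ p : G.Walk v a, p.IsPath ∧ p.length = i ∧ ∀ x ∈ p.support, x ∈ X) ∧
    ∀ b ∈ B, ∃ p : G.Walk v b, p.IsPath ∧ p.length = i ∧ ∀ x ∈ p.support, x ∈ Y

section

variable {V : Type*} [DecidableEq V] {G : SimpleGraph V} {v : V}

theorem hasTwinArms_zero (G : SimpleGraph V) (v : V) :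
    G.HasTwinArms v 0 1 {v} {v} {v} {v} := by
  refine ⟨by simp, by simp, by simp, by simp, ?_, ?_⟩ <;>
  · intro a ha
    obtain rfl := Finset.mem_singleton.1 ha
    exact ⟨Walk.nil, by simp, by simp, by simp⟩

theorem HasTwinArms.exists_succ [Fintype V] [DecidableRel G.Adj] {i m m' : ℕ} {X Y A B : Finset V}
    (h : G.HasTwinArms v i m X Y A B) (hm : m ≤ m')
    (hA : 2 * m' ≤ (G.outerNeighbors A (X ∪ Y)).card)
    (hB : 2 * m' ≤ (G.outerNeighbors B (X ∪ Y)).card) :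
    ∃ X' Y' A' B', G.HasTwinArms v (i + 1) m' X' Y' A' B' := by
  obtain ⟨hXY, hcard, -, -, hpA, hpB⟩ := h
  obtain ⟨A', hA', hcA⟩ := Finset.exists_subset_card_eq
    (show m' ≤ (G.outerNeighbors A (X ∪ Y)).card by omega)
  have hB2 : m' ≤ (G.outerNeighbors B (X ∪ Y) \ A').card := by
    have := Finset.le_card_sdiff A' (G.outerNeighbors B (X ∪ Y))
    omega
  obtain ⟨B', hB', hcB⟩ := Finset.exists_subset_card_eq hB2
  have hdisj : ∀ x ∈ A', x ∉ B' := fun x hx hx' => (Finset.mem_sdiff.1 (hB' hx')).2 hx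
  have hA'' : ∀ x ∈ A', x ∉ X ∧ x ∉ Y ∧ ∃ a ∈ A, G.Adj a x := fun x hx => by
    simpa [mem_outerNeighbors, and_assoc] using hA' hx
  have hB'' : ∀ x ∈ B', x ∉ X ∧ x ∉ Y ∧ ∃ b ∈ B, G.Adj b x := fun x hx => by
    simpa [mem_outerNeighbors, and_assoc] using (Finset.mem_sdiff.1 (hB' hx)).1
  refine ⟨X ∪ A', Y ∪ B', A', B', ?_, ?_, hcA, hcB, ?_, ?_⟩
  · intro x hx hy
    rcases Finset.mem_union.1 hx with hx | hx <;> rcases Finset.mem_union.1 hy with hy | hy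
    · exact hXY x hx hy
    · exact absurd hx (hB'' x hy).1
    · exact absurd hy (hA'' x hx).2.1
    · exact absurd hy (hdisj x hx)
  · have e : X ∪ A' ∪ (Y ∪ B') = (X ∪ Y) ∪ (A' ∪ B') := Finset.union_union_union_comm _ _ _ _
    have h1 := Finset.card_union_le (X ∪ Y) (A' ∪ B')
    have h2 := Finset.card_union_le A' B'
    have h3 : (2 * i + 1) * m ≤ (2 * i + 1) * m' := Nat.mul_le_mul_left _ hm
    rw [e]
    linarith
  · intro x hx
    obtain ⟨hxX, -, a, ha, hadj⟩ := hA'' x hx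
    obtain ⟨p, hp, hl, hsup⟩ := hpA a ha
    refine ⟨p.concat hadj, hp.concat (fun hc => hxX (hsup x hc)) hadj, by simp [hl], ?_⟩
    intro y hy
    rw [Walk.support_concat, List.mem_append, List.mem_singleton] at hy
    rcases hy with hy | rfl
    · exact Finset.mem_union_left _ (hsup y hy)
    · exact Finset.mem_union_right _ hx
  · intro x hx
    obtain ⟨-, hxY, b, hb, hadj⟩ := hB'' x hx
    obtain ⟨p, hp, hl, hsup⟩ := hpB b hb
    refine ⟨p.concat hadj, hp.concat (fun hc => hxY (hsup x hc)) hadj, by simp [hl], ?_⟩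
    intro y hy
    rw [Walk.support_concat, List.mem_append, List.mem_singleton] at hy
    rcases hy with hy | rfl
    · exact Finset.mem_union_left _ (hsup y hy)
    · exact Finset.mem_union_right _ hx

theorem HasTwinArms.exists_isCycle {k m : ℕ} {X Y A B : Finset V}
    (h : G.HasTwinArms v k m X Y A B) (hk : 1 ≤ k) {a b : V} (ha : a ∈ A) (hb : b ∈ B)
    (hab : G.Adj a b) :
    ∃ (u : V) (w : G.Walk u u), w.IsCycle ∧ w.length = 2 * k + 1 := by
  obtain ⟨hXY, -, -, -, hpA, hpB⟩ := h
  obtain ⟨p, hp, hpl, hpX⟩ := hpA a ha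
  obtain ⟨p', hp', hpl', hpY⟩ := hpB b hb
  have hav : a ≠ v := by
    rintro rfl
    have := Walk.length_eq_zero_iff.2 (Walk.isPath_iff_nil.1 hp)
    omega
  have hbv : b ≠ v := by
    rintro rfl
    have := Walk.length_eq_zero_iff.2 (Walk.isPath_iff_nil.1 hp')
    omega
  refine ⟨a, Walk.cons hab (p'.reverse.append p), (Walk.cons_isCycle_iff _ _).2 ⟨?_, ?_⟩, ?_⟩
  · rw [Walk.isPath_def, Walk.support_append, Walk.support_reverse, List.nodup_append]
    have hnd := hp.support_nodup
    refine ⟨List.nodup_reverse.2 hp'.support_nodup, hnd.tail, ?_⟩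
    rintro x hx y hy rfl
    rw [List.mem_reverse] at hx
    have hxv := hXY x (hpX x (List.mem_of_mem_tail hy)) (hpY x hx)
    rw [← p.cons_tail_support, List.nodup_cons] at hnd
    exact hnd.1 (hxv ▸ hy)
  · rw [Walk.edges_append, Walk.edges_reverse, List.mem_append, List.mem_reverse]
    rintro (he | he)
    · exact hav (hXY a (hpX a p.end_mem_support) (hpY a (p'.fst_mem_support_of_mem_edges he)))
    · exact hbv (hXY b (hpX b (p.snd_mem_support_of_mem_edges he)) (hpY b p'.end_mem_support))
  · simp only [Walk.length_cons, Walk.length_append, Walk.length_reverse, hpl, hpl']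
    omega

end

end SimpleGraph

section

variable {V : Type*} [Fintype V] [DecidableEq V] {G : SimpleGraph V} [DecidableRel G.Adj]
  {n d : ℕ} {lam : ℝ}

theorem IsNDL.exists_hasTwinArms (h : IsNDL G n d lam) (hlt : lam < d) (hlam : 0 < lam)
    {k : ℕ} (hk : 1 ≤ k) (hd : 100 * k * lam ≤ d) (hd2 : 2 ≤ d) (hn : 12 * k ≤ n) (v : V)
    (i : ℕ) (hi : i + 1 ≤ k) :
    ∃ m X Y A B, 1 ≤ m ∧ m ≤ n / (12 * k) ∧ G.HasTwinArms v (i + 1) m X Y A B ∧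
      (n / (12 * k) ≤ m ∨ (d : ℝ) / 3 * (((d : ℝ) / lam) ^ 2 / 64) ^ i ≤ m) := by
  have hk' : (1 : ℝ) ≤ k := by exact_mod_cast hk
  have hM : 1 ≤ n / (12 * k) := (Nat.one_le_div_iff (by omega)).2 hn
  have hMn : 12 * k * (n / (12 * k)) ≤ n := Nat.mul_div_le _ _
  generalize n / (12 * k) = M at *
  induction i with
  | zero =>
    have hN : G.outerNeighbors {v} ({v} ∪ {v}) = G.neighborFinset v := by
      ext t
      simp only [SimpleGraph.mem_outerNeighbors, Finset.union_idempotent, Finset.mem_singleton,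
        exists_eq_left, SimpleGraph.mem_neighborFinset, and_iff_right_iff_imp]
      exact fun hvt => hvt.ne'
    have hc : 2 * min M (d / 2) ≤ (G.outerNeighbors {v} ({v} ∪ {v})).card := by
      rw [hN, SimpleGraph.card_neighborFinset_eq_degree, h.2.1 v]
      omega
    obtain ⟨X, Y, A, B, hT⟩ := (SimpleGraph.hasTwinArms_zero G v).exists_succ
      (show 1 ≤ min M (d / 2) by omega) hc hc
    refine ⟨_, X, Y, A, B, by omega, min_le_left _ _, hT, ?_⟩
    rcases le_total M (d / 2) with h1 | h1
    · left
      rw [min_eq_left h1]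
    · right
      rw [min_eq_right h1, pow_zero, mul_one, div_le_iff₀ (by norm_num)]
      exact_mod_cast (show d ≤ d / 2 * 3 by omega)
  | succ i ih =>
    obtain ⟨m, X, Y, A, B, hm1, hmM, hT, hm⟩ := ih (by omega)
    set Q : ℝ := ((d : ℝ) / lam) ^ 2 / 32 with hQ
    have hq : 100 * (k : ℝ) ≤ d / lam := (le_div_iff₀ hlam).2 hd
    have hQ1 : 1 ≤ Q := by
      rw [hQ, le_div_iff₀ (by norm_num)]
      nlinarith
    have hm1' : (1 : ℝ) ≤ m := by exact_mod_cast hm1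
    have hQm : (m : ℝ) ≤ Q * m := by nlinarith
    have hmfl : m ≤ ⌊Q * m⌋₊ := Nat.le_floor hQm
    have hfl : (⌊Q * m⌋₊ : ℝ) ≤ Q * m := Nat.floor_le (by positivity)
    have hexp : ∀ S : Finset V, S.card = m →
        2 * min M ⌊Q * m⌋₊ ≤ (G.outerNeighbors S (X ∪ Y)).card := fun S hS => by
      have hXY : (X ∪ Y).card ≤ 3 * k * m :=
        hT.2.1.trans (Nat.mul_le_mul_right _ (by omega))
      have hXn : 4 * (X ∪ Y).card ≤ n := by
        calc 4 * (X ∪ Y).card ≤ 4 * (3 * k * M) := by gcongr; exact hXY.trans (by gcongr)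
          _ = 12 * k * M := by ring
          _ ≤ n := hMn
      rcases h.le_card_outerNeighbors hlt (by omega) hlam (S := S) (X := X ∪ Y) (C := 3 * k)
        (by exact_mod_cast hXn) (by rw [hS]; exact_mod_cast hXY) (by
          have h1 : (100 * k * lam) ^ 2 ≤ (d : ℝ) ^ 2 := by gcongr
          have h2 : (k : ℝ) * lam ^ 2 ≤ k ^ 2 * lam ^ 2 := by
            gcongr
            nlinarith
          have h3 : 0 ≤ (k : ℝ) ^ 2 * lam ^ 2 := by positivity
          nlinarith) with h1 | h1
      · have h1 : n ≤ 4 * (G.outerNeighbors S (X ∪ Y)).card := by exact_mod_cast h1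
        have h2 : 12 * M ≤ 12 * k * M := Nat.mul_le_mul_right _ (by omega)
        omega
      · rw [hS] at h1
        have h2 : 2 * (Q * m) ≤ (G.outerNeighbors S (X ∪ Y)).card := by
          have e : 2 * (Q * m) = (d : ℝ) ^ 2 * m / (16 * lam ^ 2) := by
            rw [hQ]
            field_simp
            norm_num
          rw [e, div_le_iff₀ (by positivity)]
          linarith
        have h3 : 2 * ⌊Q * m⌋₊ ≤ (G.outerNeighbors S (X ∪ Y)).card := by
          have : (2 * ⌊Q * m⌋₊ : ℝ) ≤ (G.outerNeighbors S (X ∪ Y)).card := by linarith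
          exact_mod_cast this
        omega
    obtain ⟨X', Y', A', B', hT'⟩ := hT.exists_succ (le_min hmM hmfl)
      (hexp A hT.2.2.1) (hexp B hT.2.2.2.1)
    refine ⟨_, X', Y', A', B', by omega, min_le_left _ _, hT', ?_⟩
    rcases hm with hm | hm
    · left
      omega
    rcases le_total M ⌊Q * m⌋₊ with h1 | h1
    · left
      rw [min_eq_left h1]
    · right
      rw [min_eq_right h1]
      have h2 := Nat.lt_floor_add_one (Q * m)
      have h3 : (1 : ℝ) ≤ ⌊Q * m⌋₊ := by exact_mod_cast hm1.trans hmfl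
      have h4 : (d : ℝ) / 3 * (((d : ℝ) / lam) ^ 2 / 64) ^ (i + 1)
          = Q / 2 * ((d : ℝ) / 3 * (((d : ℝ) / lam) ^ 2 / 64) ^ i) := by
        rw [hQ, pow_succ]
        ring
      rw [h4]
      have h5 := mul_le_mul_of_nonneg_left hm (show 0 ≤ Q / 2 by positivity)
      linarith

theorem IsNDL.exists_isCycle (h : IsNDL G n d lam) (hlam : 0 < lam) (hn0 : 0 < n)
    {k : ℕ} (hk : 1 ≤ k) (hd : 100 * k * lam ≤ d)
    (hdn : 3 * 64 ^ k * (n * lam ^ (2 * k - 1)) ≤ (d : ℝ) ^ (2 * k)) :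
    ∃ (v : V) (w : G.Walk v v), w.IsCycle ∧ w.length = 2 * k + 1 := by
  have hk' : (1 : ℝ) ≤ k := by exact_mod_cast hk
  have hlt : lam < d := by nlinarith
  have hn' : (0 : ℝ) < n := by exact_mod_cast hn0
  obtain ⟨v⟩ : Nonempty V := Fintype.card_pos_iff.1 (by rw [h.1]; exact hn0)
  have hdlam : (d : ℝ) ≤ n * lam := by
    have h1 := (abs_le.1 (h.mixing hlt hn0 hlam {v} {v})).1
    rw [SimpleGraph.adjPairs_eq_zero (by simp)] at h1
    simp only [Finset.card_singleton, Nat.cast_one, mul_one, Real.sqrt_one, zero_sub,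
      neg_le_neg_iff] at h1
    rw [div_le_iff₀ hn'] at h1
    linarith
  have hn100 : 100 * k ≤ n := by
    have : (100 * k : ℝ) ≤ n := le_of_mul_le_mul_right (hd.trans hdlam) hlam
    exact_mod_cast this
  have hd2 : 2 ≤ d := by
    have hcard : (G.outerNeighbors {v} ∅).card = d := by
      rw [← h.2.1 v, ← SimpleGraph.card_neighborFinset_eq_degree]
      congr 1
      ext t
      simp [SimpleGraph.mem_outerNeighbors]
    rcases h.le_card_outerNeighbors hlt hn0 hlam (S := {v}) (X := ∅) (C := 0) (by simp) (by simp)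
      (by simp) with h1 | h1
    · rw [hcard] at h1
      have h1 : n ≤ 4 * d := by exact_mod_cast h1
      omega
    · rw [hcard, Finset.card_singleton, Nat.cast_one, mul_one] at h1
      have h2 : (100 * lam) ^ 2 ≤ (d : ℝ) ^ 2 := by
        gcongr
        nlinarith
      have h3 : lam ^ 2 * 2 ≤ lam ^ 2 * d := by
        have : 0 < lam ^ 2 := by positivity
        nlinarith
      have h4 : (2 : ℝ) ≤ d := le_of_mul_le_mul_left h3 (by positivity)
      exact_mod_cast h4
  obtain ⟨j, rfl⟩ : ∃ j, k = j + 1 := ⟨k - 1, by omega⟩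
  obtain ⟨m, X, Y, A, B, hm1, -, hT, hm⟩ :=
    h.exists_hasTwinArms hlt hlam hk hd hd2 (by omega) v j le_rfl
  by_cases hAB : ∃ a ∈ A, ∃ b ∈ B, G.Adj a b
  · obtain ⟨a, ha, b, hb, hab⟩ := hAB
    exact hT.exists_isCycle hk ha hb hab
  exfalso
  push Not at hAB
  have hmix := (abs_le.1 (h.mixing hlt hn0 hlam A B)).1
  have hm0 : (0 : ℝ) < m := by exact_mod_cast hm1
  rw [SimpleGraph.adjPairs_eq_zero hAB, hT.2.2.1, hT.2.2.2.1, Real.sqrt_mul_self hm0.le,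
    zero_sub, neg_le_neg_iff, div_le_iff₀ hn'] at hmix
  have hdm : (d : ℝ) * m ≤ lam * n := le_of_mul_le_mul_right (by linarith) hm0
  rcases hm with hm | hm
  · have h1 : n < 12 * (j + 1) * (n / (12 * (j + 1)) + 1) :=
      Nat.lt_mul_div_succ _ (by omega)
    have h2 : 12 * (j + 1) * (n / (12 * (j + 1)) + 1) ≤ 12 * (j + 1) * (2 * m) :=
      Nat.mul_le_mul_left _ (by omega)
    have h3 : (n : ℝ) < 24 * ((j + 1 : ℕ) : ℝ) * m := by
      have : n < 24 * (j + 1) * m := by linarith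
      exact_mod_cast this
    have h4 := mul_le_mul_of_nonneg_right hd hm0.le
    nlinarith [mul_lt_mul_of_pos_left h3 hlam, mul_pos hlam hn']
  · have h1 := (mul_le_mul_of_nonneg_left hm (Nat.cast_nonneg d)).trans hdm
    have h2 : (d : ℝ) * (d / 3 * ((d / lam) ^ 2 / 64) ^ j)
        = d ^ (2 * (j + 1)) / (3 * 64 ^ j * lam ^ (2 * j)) := by
      rw [div_pow, div_pow, div_pow, ← pow_mul, ← pow_mul]
      field_simp
      ring
    rw [h2, div_le_iff₀ (by positivity)] at h1
    have h3 := hdn.trans h1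
    rw [show 2 * (j + 1) - 1 = 2 * j + 1 by omega, pow_succ, pow_succ] at h3
    have h4 : 0 < (64 : ℝ) ^ j * (lam ^ (2 * j) * (lam * n)) := by positivity
    nlinarith

end

/-- Let `k ≥ 1` be a fixed integer and `(G i)` a sequence of graphs, where `G i` is an
`(n i, d i, λ i)`-graph with `λ i > 0`, such that `(d i)^{2k}/(n i · (λ i)^{2k−1}) → ∞`.
Then for all sufficiently large `i`, the graph `G i` contains a cycle of length `2k + 1`. -/
theorem stmt_16 (k : ℕ) (hk : 1 ≤ k)
    (V : ℕ → Type) [∀ i, Fintype (V i)] [∀ i, DecidableEq (V i)]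
    (G : ∀ i, SimpleGraph (V i)) [∀ i, DecidableRel (G i).Adj]
    (n d : ℕ → ℕ) (lam : ℕ → ℝ)
    (h : ∀ i, IsNDL (G i) (n i) (d i) (lam i)) (hpos : ∀ i, 0 < lam i)
    (hlim : Filter.Tendsto
      (fun i => ((d i : ℝ)) ^ (2 * k) / ((n i : ℝ) * (lam i) ^ (2 * k - 1)))
      Filter.atTop Filter.atTop) :
    ∀ᶠ i in Filter.atTop,
      ∃ (v : V i) (w : (G i).Walk v v), w.IsCycle ∧ w.length = 2 * k + 1 := by
  filter_upwards [hlim.eventually_ge_atTop (((100 * k : ℝ)) ^ (2 * k - 1) + 3 * 64 ^ k)] with i hi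
  have hlam := hpos i
  have hA : (0 : ℝ) < (100 * k : ℝ) ^ (2 * k - 1) := by positivity
  have hB : (0 : ℝ) < 3 * 64 ^ k := by positivity
  have hn0 : 0 < n i := by
    rcases Nat.eq_zero_or_pos (n i) with h0 | h0
    · rw [h0, Nat.cast_zero, zero_mul, div_zero] at hi
      linarith
    · exact h0
  have hn' : (0 : ℝ) < n i := by exact_mod_cast hn0
  rw [le_div_iff₀ (by positivity), add_mul] at hi
  have hden : 0 < (n i : ℝ) * lam i ^ (2 * k - 1) := by positivity
  refine (h i).exists_isCycle hlam hn0 hk ?_ (by nlinarith)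
  have hdn : (d i : ℝ) ≤ n i := by
    obtain ⟨v⟩ : Nonempty (V i) := Fintype.card_pos_iff.1 (by rw [(h i).1]; exact hn0)
    have h1 := (G i).degree_lt_card_verts v
    rw [(h i).2.1 v, (h i).1] at h1
    exact_mod_cast h1.le
  refine le_of_pow_le_pow_left₀ (show 2 * k - 1 ≠ 0 by omega) (Nat.cast_nonneg _) ?_
  refine le_of_mul_le_mul_left ?_ hn'
  calc (n i : ℝ) * (100 * k * lam i) ^ (2 * k - 1)
      = (100 * k : ℝ) ^ (2 * k - 1) * (n i * lam i ^ (2 * k - 1)) := by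
        rw [mul_pow (100 * k : ℝ)]
        ring
    _ ≤ (d i : ℝ) ^ (2 * k) := by nlinarith
    _ = d i * (d i : ℝ) ^ (2 * k - 1) := by
        rw [← pow_succ', show 2 * k - 1 + 1 = 2 * k by omega]
    _ ≤ n i * (d i : ℝ) ^ (2 * k - 1) := by gcongr
end
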